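/- Let k ≥ 2, s > 2k, C ≥ 2 and δ = 8^{−2k}, and let J_{k,s} be the continuous positive function on Λ_k^{(s)} arising as the singular integral. For P ≥ 2, let 𝒦(P) be the union over 0 < η ≤ 2 of the sets 𝒦(P,η) of all λ ∈ Λ_k^{(s)}(C) with |I_λ(P,η) − η J_{k,s}(λ) P^{s−k}| > 2 P^{s−k−3δ}. Then the Lebesgue measure of 𝒦(P) is ≪ P^{−3δ}, with an implicit constant depending only on k, s, C. -/

import Mathlib

open MeasureTheory

/-- e(t) = e^{2πit}. -/
noncomputable def eF (t : ℝ) : ℂ := Complex.exp (2 * Real.pi * Complex.I * t)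

/-- v(α) = ∫_{−P}^{P} e(α ξ^k) dξ. -/
noncomputable def vInt (k : ℕ) (P α : ℝ) : ℂ := ∫ ξ in (-P)..P, eF (α * ξ ^ k)

/-- The measure d_η α = η (sin(πηα)/(πηα))² dα on ℝ. -/
noncomputable def dEta (η : ℝ) : Measure ℝ :=
  volume.withDensity fun α =>
    ENNReal.ofReal (η * (Real.sin (Real.pi * η * α) / (Real.pi * η * α)) ^ 2)

/-- δ = 8^{−2k}. -/
noncomputable def dlt (k : ℕ) : ℝ := ((8 : ℝ) ^ (2 * k))⁻¹

/-- Λ_k^{(s)}: s-tuples of nonzero reals; for even k additionally some λ_i λ_j < 0. -/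
def Lam (k s : ℕ) : Set (Fin s → ℝ) :=
  {l | (∀ j, l j ≠ 0) ∧ (Even k → ∃ i j, l i * l j < 0)}

/-- Λ_k^{(s)}(C) = {λ ∈ Λ_k^{(s)} : 1/C ≤ |λ_j| ≤ C}. -/
def LamC (k s : ℕ) (C : ℝ) : Set (Fin s → ℝ) :=
  {l | l ∈ Lam k s ∧ ∀ j, 1 / C ≤ |l j| ∧ |l j| ≤ C}

/-- I_λ(P,η) = Σ_{x ∈ ℤ^s, |x| ≤ P} W_η(λ_1x_1^k + ⋯ + λ_sx_s^k),
where W_η(α) = max(0, 1 − |α|/η). -/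
noncomputable def Icount (k s : ℕ) (l : Fin s → ℝ) (P η : ℝ) : ℝ :=
  ∑ x ∈ Fintype.piFinset (fun _ : Fin s => Finset.Icc (-(⌊P⌋ : ℤ)) ⌊P⌋),
    max 0 (1 - |∑ j, l j * ((x j : ℤ) : ℝ) ^ k| / η)

open Set Filter Topology

open scoped Real FourierTransform ENNReal

/-- The tent function `W_η(t) = max(0, 1 − |t|/η)`. -/
noncomputable def tent (η t : ℝ) : ℝ := max 0 (1 - |t| / η)

/-- The density of `dEta η` with respect to Lebesgue measure. -/
noncomputable def sincSq (η α : ℝ) : ℝ :=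
  η * (Real.sin (Real.pi * η * α) / (Real.pi * η * α)) ^ 2

theorem dEta_eq (η : ℝ) : dEta η = volume.withDensity fun α => ENNReal.ofReal (sincSq η α) := rfl

theorem eF_def' (t : ℝ) : eF t = Complex.exp ((2 * Real.pi * t : ℝ) * Complex.I) := by
  rw [eF]; congr 1; push_cast; ring

theorem norm_eF (t : ℝ) : ‖eF t‖ = 1 := by
  rw [eF_def', Complex.norm_exp_ofReal_mul_I]

theorem eF_zero : eF 0 = 1 := by simp [eF]

theorem eF_add (s t : ℝ) : eF (s + t) = eF s * eF t := by
  rw [eF, eF, eF, ← Complex.exp_add]; congr 1; push_cast; ring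

theorem eF_sum {ι : Type*} (u : Finset ι) (g : ι → ℝ) :
    eF (∑ i ∈ u, g i) = ∏ i ∈ u, eF (g i) := by
  classical
  induction u using Finset.induction_on with
  | empty => simp [eF_zero]
  | insert a u ha ih => rw [Finset.sum_insert ha, Finset.prod_insert ha, eF_add, ih]

theorem star_eF (t : ℝ) : (starRingEnd ℂ) (eF t) = eF (-t) := by
  rw [eF_def', eF_def', ← Complex.exp_conj]
  congr 1
  rw [map_mul, Complex.conj_I, Complex.conj_ofReal]
  push_cast; ring

@[fun_prop]
theorem continuous_eF : Continuous eF := by unfold eF; fun_prop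

@[fun_prop]
theorem measurable_sincSq (η : ℝ) : Measurable (sincSq η) := by unfold sincSq; fun_prop

theorem sincSq_nonneg {η : ℝ} (hη : 0 < η) (α : ℝ) : 0 ≤ sincSq η α := by
  unfold sincSq; positivity

theorem sincSq_le_self {η : ℝ} (hη : 0 < η) (α : ℝ) : sincSq η α ≤ η := by
  unfold sincSq
  have h : |Real.sin (π * η * α) / (π * η * α)| ≤ 1 := by
    rw [abs_div]
    exact div_le_one_of_le₀ Real.abs_sin_le_abs (abs_nonneg _)
  have h2 := (sq_le_one_iff_abs_le_one _).2 h
  nlinarith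

theorem sincSq_le_inv {η : ℝ} (hη : 0 < η) {α : ℝ} (hα : α ≠ 0) :
    sincSq η α ≤ 1 / (η * α ^ 2) := by
  unfold sincSq
  have h := Real.sin_sq_le_one (π * η * α)
  have hpi : (1 : ℝ) ≤ π ^ 2 := by nlinarith [Real.pi_gt_three]
  have hα2 : 0 < α ^ 2 := by positivity
  rw [div_pow, le_div_iff₀ (by positivity)]
  have : η * (Real.sin (π * η * α) ^ 2 / (π * η * α) ^ 2) * (η * α ^ 2)
      = Real.sin (π * η * α) ^ 2 / π ^ 2 := by
    field_simp
  rw [this, div_le_one (by positivity)]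
  linarith

/-- A majorant of the densities `sincSq η` that is uniform for `η ∈ [1/Q, 2]`. -/
theorem sincSq_le_of_mem {η Q : ℝ} (hQ : 1 ≤ Q) (h1 : 1 / Q ≤ η) (h2 : η ≤ 2) (α : ℝ) :
    sincSq η α ≤ 4 * Q * (1 + α ^ 2)⁻¹ := by
  have hQ0 : 0 < Q := by linarith
  have hη : 0 < η := lt_of_lt_of_le (by positivity) h1
  rw [← div_eq_mul_inv, le_div_iff₀ (by positivity)]
  rcases le_or_gt (α ^ 2) 1 with h | h
  · have := sincSq_le_self hη α
    have h0 := sincSq_nonneg hη α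
    nlinarith
  · have hα : α ≠ 0 := by rintro rfl; norm_num at h
    have := sincSq_le_inv hη hα
    have h3 : 1 / (η * α ^ 2) ≤ Q / α ^ 2 := by
      rw [div_le_div_iff₀ (by positivity) (by positivity)]
      rw [div_le_iff₀ hQ0] at h1
      nlinarith
    calc sincSq η α * (1 + α ^ 2) ≤ Q / α ^ 2 * (1 + α ^ 2) := by gcongr; linarith
      _ ≤ Q / α ^ 2 * (2 * α ^ 2) := by gcongr; linarith
      _ = 2 * Q := by field_simp
      _ ≤ 4 * Q := by linarith

theorem integrable_sincSq {η : ℝ} (hη : 0 < η) : Integrable (sincSq η) := by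
  have hc : Integrable fun α : ℝ => (η + 1 / η) * (1 + α ^ 2)⁻¹ :=
    integrable_inv_one_add_sq.const_mul _
  refine hc.mono' (measurable_sincSq η).aestronglyMeasurable (ae_of_all _ fun α => ?_)
  rw [Real.norm_of_nonneg (sincSq_nonneg hη α), ← div_eq_mul_inv, le_div_iff₀ (by positivity)]
  have h1 := sincSq_le_self hη α
  rcases eq_or_ne α 0 with rfl | hα
  · have : 0 < 1 / η := by positivity
    linarith
  · have h2 := sincSq_le_inv hη hα
    have h3 : sincSq η α * α ^ 2 ≤ 1 / η := by
      calc sincSq η α * α ^ 2 ≤ 1 / (η * α ^ 2) * α ^ 2 := by gcongr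
        _ = 1 / η := by field_simp
    linarith

theorem isFiniteMeasure_dEta {η : ℝ} (hη : 0 < η) : IsFiniteMeasure (dEta η) :=
  isFiniteMeasure_withDensity_ofReal (integrable_sincSq hη).2

theorem integral_dEta {E : Type*} [NormedAddCommGroup E] [NormedSpace ℝ E] {η : ℝ} (hη : 0 < η)
    (g : ℝ → E) : ∫ α, g α ∂dEta η = ∫ α, sincSq η α • g α := by
  rw [dEta_eq, integral_withDensity_eq_integral_toReal_smul (by fun_prop)
    (ae_of_all _ fun _ => ENNReal.ofReal_lt_top)]
  simp_rw [ENNReal.toReal_ofReal (sincSq_nonneg hη _)]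

theorem continuous_tent (η : ℝ) : Continuous (tent η) := by unfold tent; fun_prop

theorem tent_of_le {η t : ℝ} (hη : 0 < η) (h : η ≤ |t|) : tent η t = 0 := by
  unfold tent
  refine max_eq_left ?_
  have : 1 ≤ |t| / η := (one_le_div hη).2 h
  linarith

theorem tent_of_abs_le {η t : ℝ} (hη : 0 < η) (h : |t| ≤ η) : tent η t = 1 - |t| / η := by
  unfold tent
  refine max_eq_right ?_
  have := div_le_one_of_le₀ h hη.le
  linarith

theorem integrable_tent {η : ℝ} (hη : 0 < η) : Integrable fun t => (tent η t : ℂ) := by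
  refine Continuous.integrable_of_hasCompactSupport
    (Complex.continuous_ofReal.comp (continuous_tent η)) ?_
  refine HasCompactSupport.intro (isCompact_Icc (a := -η) (b := η)) fun x hx => ?_
  have : η ≤ |x| := by
    by_contra! h
    exact hx (abs_le.1 h.le)
  simp [tent_of_le hη this]

theorem integral_one_add_mul_exp {η : ℝ} (hη : 0 < η) {c : ℂ} (hc : c ≠ 0) (σ : ℝ) (a b : ℝ) :
    ∫ x in a..b, ((1 + σ * x / η : ℝ) : ℂ) * Complex.exp (c * x) =
      (((1 + σ * b / η : ℝ) : ℂ) * Complex.exp (c * b) / c -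
        σ * Complex.exp (c * b) / (η * c ^ 2)) -
      (((1 + σ * a / η : ℝ) : ℂ) * Complex.exp (c * a) / c -
        σ * Complex.exp (c * a) / (η * c ^ 2)) := by
  have hη' : (η : ℂ) ≠ 0 := by exact_mod_cast hη.ne'
  refine intervalIntegral.integral_eq_sub_of_hasDerivAt (f := fun x : ℝ =>
    ((1 + σ * x / η : ℝ) : ℂ) * Complex.exp (c * x) / c -
        σ * Complex.exp (c * x) / (η * c ^ 2)) (fun x _ => ?_)
    (Continuous.intervalIntegrable (by fun_prop) _ _)
  have hid : HasDerivAt (fun x : ℝ => (x : ℂ)) 1 x := Complex.ofRealCLM.hasDerivAt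
  have h1 : HasDerivAt (fun x : ℝ => Complex.exp (c * x)) (Complex.exp (c * x) * (c * 1)) x :=
    (hid.const_mul c).cexp
  have h2 : HasDerivAt (fun x : ℝ => ((1 + σ * x / η : ℝ) : ℂ)) (σ * 1 / η) x := by
    have := ((hid.const_mul (σ : ℂ)).div_const (η : ℂ)).const_add 1
    refine this.congr_of_eventuallyEq (Eventually.of_forall fun y => ?_)
    push_cast; ring
  refine (((h2.mul h1).div_const c).sub
    ((h1.const_mul (σ : ℂ)).div_const (η * c ^ 2))).congr_deriv ?_
  push_cast
  field_simp
  ring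

theorem integral_tent_mul_exp {η : ℝ} (hη : 0 < η) {c : ℂ} (hc : c ≠ 0) :
    ∫ x : ℝ, (tent η x : ℂ) * Complex.exp (c * x) =
      (Complex.exp (c * η) + Complex.exp (-(c * η)) - 2) / (η * c ^ 2) := by
  have hη' : (η : ℂ) ≠ 0 := by exact_mod_cast hη.ne'
  have hcont : Continuous fun x : ℝ => (tent η x : ℂ) * Complex.exp (c * x) :=
    (Complex.continuous_ofReal.comp (continuous_tent η)).mul (by fun_prop)
  have hsupp : ∫ x : ℝ, (tent η x : ℂ) * Complex.exp (c * x) =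
      ∫ x in (-η)..η, (tent η x : ℂ) * Complex.exp (c * x) := by
    rw [intervalIntegral.integral_of_le (by linarith)]
    refine (setIntegral_eq_integral_of_forall_compl_eq_zero fun x hx => ?_).symm
    have : η ≤ |x| := by
      by_contra! h
      exact hx ⟨(abs_lt.1 h).1, (abs_lt.1 h).2.le⟩
    simp [tent_of_le hη this]
  rw [hsupp, ← intervalIntegral.integral_add_adjacent_intervals (b := 0)
    (hcont.intervalIntegrable _ _) (hcont.intervalIntegrable _ _)]
  have e1 : ∫ x in (-η)..0, (tent η x : ℂ) * Complex.exp (c * x) =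
      ∫ x in (-η)..0, ((1 + (1 : ℝ) * x / η : ℝ) : ℂ) * Complex.exp (c * x) := by
    refine intervalIntegral.integral_congr fun x hx => ?_
    rw [uIcc_of_le (by linarith)] at hx
    have habs : |x| = -x := abs_of_nonpos hx.2
    rw [tent_of_abs_le hη (by rw [habs]; linarith [hx.1]), habs]
    push_cast; ring
  have e2 : ∫ x in (0 : ℝ)..η, (tent η x : ℂ) * Complex.exp (c * x) =
      ∫ x in (0 : ℝ)..η, ((1 + (-1 : ℝ) * x / η : ℝ) : ℂ) * Complex.exp (c * x) := by
    refine intervalIntegral.integral_congr fun x hx => ?_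
    rw [uIcc_of_le (by linarith)] at hx
    have habs : |x| = x := abs_of_nonneg hx.1
    rw [tent_of_abs_le hη (by rw [habs]; linarith [hx.2]), habs]
    push_cast; ring
  rw [e1, e2, integral_one_add_mul_exp hη hc, integral_one_add_mul_exp hη hc]
  push_cast
  simp only [mul_neg, mul_zero, Complex.exp_zero]
  field_simp
  ring

theorem fourier_tent {η : ℝ} (hη : 0 < η) {α : ℝ} (hα : α ≠ 0) :
    𝓕 (fun t : ℝ => (tent η t : ℂ)) α = (sincSq η α : ℂ) := by
  rw [Real.fourier_real_eq_integral_exp_smul]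
  have hpi := Real.pi_ne_zero
  set c : ℂ := ((-2 * π * α : ℝ) : ℂ) * Complex.I with hc
  have hc0 : c ≠ 0 := by
    rw [hc]
    refine mul_ne_zero ?_ Complex.I_ne_zero
    exact_mod_cast mul_ne_zero (mul_ne_zero (by norm_num) hpi) hα
  have h1 : ∀ t : ℝ, Complex.exp (((-2 * π * t * α : ℝ) : ℂ) * Complex.I) • (tent η t : ℂ) =
      (tent η t : ℂ) * Complex.exp (c * t) := by
    intro t
    rw [smul_eq_mul, mul_comm, hc]
    congr 2; push_cast; ring
  simp_rw [h1]
  rw [integral_tent_mul_exp hη hc0]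
  have h2 : Complex.exp (c * η) + Complex.exp (-(c * η)) =
      2 * (Real.cos (2 * (π * η * α)) : ℂ) := by
    rw [Complex.ofReal_cos, Complex.two_cos, add_comm]
    congr 2
    · rw [hc]; push_cast; ring
    · rw [hc]; push_cast; ring
  have h3 : c ^ 2 = -((4 * π ^ 2 * α ^ 2 : ℝ) : ℂ) := by
    rw [hc, mul_pow, Complex.I_sq]; push_cast; ring
  rw [h2, h3, Real.cos_two_mul, Real.cos_sq', sincSq]
  have hα' : (α : ℂ) ≠ 0 := by exact_mod_cast hα
  have hη' : (η : ℂ) ≠ 0 := by exact_mod_cast hη.ne'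
  have hpi' : (π : ℂ) ≠ 0 := by exact_mod_cast hpi
  push_cast
  field_simp
  ring

theorem integral_eF_dEta {η : ℝ} (hη : 0 < η) (t : ℝ) :
    ∫ α, eF (t * α) ∂dEta η = (tent η t : ℂ) := by
  have hae : (𝓕 (fun t : ℝ => (tent η t : ℂ))) =ᵐ[volume] fun α => (sincSq η α : ℂ) := by
    have : ∀ᵐ α : ℝ, α ≠ 0 := by simp [ae_iff]
    filter_upwards [this] with α hα using fourier_tent hη hα
  have hint : Integrable (𝓕 (fun t : ℝ => (tent η t : ℂ))) :=
    (integrable_sincSq hη).ofReal.congr hae.symm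
  have hinv := (integrable_tent hη).fourierInv_fourier_eq hint
    (v := t) (Complex.continuous_ofReal.comp (continuous_tent η)).continuousAt
  rw [Real.fourierInv_eq'] at hinv
  rw [integral_dEta hη, ← hinv]
  refine integral_congr_ae ?_
  filter_upwards [hae] with α hα
  rw [hα, eF_def', smul_eq_mul, Complex.real_smul, mul_comm]
  congr 3

theorem measureReal_dEta_univ {η : ℝ} (hη : 0 < η) : (dEta η).real univ = 1 := by
  have := integral_eF_dEta hη 0
  have ht : tent η 0 = 1 := by simp [tent]
  simp only [zero_mul, eF_zero, integral_const, ht] at this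
  simpa using congrArg Complex.re this

/-- The exponential sum `f(β) = ∑_{|x| ≤ N} e(β x^k)`. -/
noncomputable def weylSum (k N : ℕ) (β : ℝ) : ℂ :=
  ∑ x ∈ Finset.Icc (-(N : ℤ)) N, eF (β * (x : ℝ) ^ k)

@[fun_prop]
theorem continuous_weylSum (k N : ℕ) : Continuous (weylSum k N) := by
  unfold weylSum; fun_prop

theorem norm_weylSum_le (k N : ℕ) (β : ℝ) : ‖weylSum k N β‖ ≤ 2 * N + 1 := by
  unfold weylSum
  refine (norm_sum_le _ _).trans ?_
  simp only [norm_eF, Finset.sum_const, Int.card_Icc, nsmul_eq_mul, mul_one]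
  have : ((N : ℤ) + 1 - -N).toNat = 2 * N + 1 := by omega
  rw [this]; push_cast; rfl

theorem integrable_eF_dEta {η : ℝ} (hη : 0 < η) (t : ℝ) :
    Integrable (fun α => eF (t * α)) (dEta η) := by
  have := isFiniteMeasure_dEta hη
  refine Integrable.of_bound (C := 1)
    (Continuous.aestronglyMeasurable (by fun_prop)) (ae_of_all _ fun α => ?_)
  rw [norm_eF]

theorem integral_prod_weylSum (k s : ℕ) (l : Fin s → ℝ) {P η : ℝ} (hP : 0 ≤ P) (hη : 0 < η) :
    ∫ α, ∏ j, weylSum k ⌊P⌋₊ (l j * α) ∂dEta η = (Icount k s l P η : ℂ) := by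
  have hfl : ((⌊P⌋₊ : ℕ) : ℤ) = ⌊P⌋ := Int.natCast_floor_eq_floor hP
  have h1 : ∀ α : ℝ, ∏ j, weylSum k ⌊P⌋₊ (l j * α) =
      ∑ x ∈ Fintype.piFinset (fun _ : Fin s => Finset.Icc (-(⌊P⌋ : ℤ)) ⌊P⌋),
        eF ((∑ j, l j * ((x j : ℤ) : ℝ) ^ k) * α) := by
    intro α
    unfold weylSum
    rw [hfl, Finset.prod_univ_sum]
    refine Finset.sum_congr rfl fun x _ => ?_
    rw [Finset.sum_mul, eF_sum]
    refine Finset.prod_congr rfl fun j _ => ?_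
    congr 1; ring
  simp_rw [h1]
  rw [integral_finsetSum _ fun x _ => integrable_eF_dEta hη _]
  simp_rw [integral_eF_dEta hη]
  rw [Icount]
  push_cast
  rfl

theorem integral_normSq_weylSum (k N : ℕ) (α : ℝ) {η : ℝ} (hη : 0 < η) :
    ∫ t, ‖weylSum k N (t * α)‖ ^ 2 ∂dEta η =
      ∑ x ∈ Finset.Icc (-(N : ℤ)) N, ∑ y ∈ Finset.Icc (-(N : ℤ)) N,
        tent η (α * ((x : ℝ) ^ k - (y : ℝ) ^ k)) := by
  have h1 : ∀ t : ℝ, ((‖weylSum k N (t * α)‖ ^ 2 : ℝ) : ℂ) =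
      ∑ x ∈ Finset.Icc (-(N : ℤ)) N, ∑ y ∈ Finset.Icc (-(N : ℤ)) N,
        eF ((α * ((x : ℝ) ^ k - (y : ℝ) ^ k)) * t) := by
    intro t
    rw [Complex.ofReal_pow, ← Complex.mul_conj']
    unfold weylSum
    rw [map_sum, Finset.sum_mul_sum]
    refine Finset.sum_congr rfl fun x _ => Finset.sum_congr rfl fun y _ => ?_
    rw [star_eF, ← eF_add]
    congr 1; ring
  apply Complex.ofReal_injective
  rw [← integral_complex_ofReal]
  simp_rw [h1]
  rw [integral_finsetSum _ fun x _ => integrable_finsetSum _ fun y _ => integrable_eF_dEta hη _]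
  simp_rw [integral_finsetSum _ fun y _ => integrable_eF_dEta hη _, integral_eF_dEta hη]
  push_cast
  rfl

theorem abs_sub_mul_le_of_sub_pow {k : ℕ} (hk : 2 ≤ k) {a b B D : ℝ} (hb : 0 ≤ b) (hab : b ≤ a)
    (hD : 0 ≤ D) (hBD : B ^ 2 ≤ D ^ k) (h : a ^ k - b ^ k ≤ B) : (a - b) * a ≤ D := by
  obtain ⟨m, rfl⟩ := Nat.exists_eq_add_of_le hk
  have ha : 0 ≤ a := hb.trans hab
  have h1 : (a - b) * a ^ (m + 1) ≤ B := by
    have : b ^ (m + 1) ≤ a ^ (m + 1) := by gcongr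
    have h2 : b * b ^ (m + 1) ≤ b * a ^ (m + 1) := by gcongr
    have h3 : a ^ (2 + m) - b ^ (2 + m) = a * a ^ (m + 1) - b * b ^ (m + 1) := by ring
    linarith
  have hab0 : 0 ≤ a - b := by linarith
  refine le_of_pow_le_pow_left₀ (n := 2 + m) (by omega) hD (le_trans ?_ hBD)
  calc ((a - b) * a) ^ (2 + m) = (a - b) ^ 2 * (a - b) ^ m * a ^ (2 + m) := by
        rw [mul_pow, pow_add (a - b)]
    _ ≤ (a - b) ^ 2 * a ^ m * a ^ (2 + m) := by gcongr; linarith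
    _ = ((a - b) * a ^ (m + 1)) ^ 2 := by rw [mul_pow, ← pow_mul]; ring
    _ ≤ B ^ 2 := by gcongr

theorem abs_sub_mul_le {k : ℕ} (hk : 2 ≤ k) {a b B D : ℝ} (ha : 0 ≤ a) (hb : 0 ≤ b)
    (hD : 0 ≤ D) (hBD : B ^ 2 ≤ D ^ k) (h : |a ^ k - b ^ k| ≤ B) :
    |b - a| * a ≤ D ∧ |b - a| * b ≤ D := by
  rw [abs_le] at h
  rcases le_total b a with hab | hab
  · have := abs_sub_mul_le_of_sub_pow hk hb hab hD hBD h.2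
    rw [abs_of_nonpos (by linarith)]
    constructor <;> nlinarith
  · have := abs_sub_mul_le_of_sub_pow hk ha hab hD hBD (by linarith)
    rw [abs_of_nonneg (by linarith)]
    constructor <;> nlinarith

theorem card_filter_abs_sub_le (A : Finset ℤ) (c : ℝ) {r : ℝ} (hr : 0 ≤ r) :
    ((A.filter fun y : ℤ => |(y : ℝ) - c| ≤ r).card : ℝ) ≤ 2 * r + 1 := by
  have hsub : (A.filter fun y : ℤ => |(y : ℝ) - c| ≤ r) ⊆ Finset.Icc ⌈c - r⌉ ⌊c + r⌋ := by
    intro y hy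
    have := abs_le.1 (Finset.mem_filter.1 hy).2
    rw [Finset.mem_Icc, Int.ceil_le, Int.le_floor]
    constructor <;> linarith
  have h1 : ((A.filter fun y : ℤ => |(y : ℝ) - c| ≤ r).card : ℝ) ≤
      (Finset.Icc ⌈c - r⌉ ⌊c + r⌋).card := by exact_mod_cast Finset.card_le_card hsub
  refine h1.trans ?_
  rw [Int.card_Icc]
  have h2 : ((⌊c + r⌋ + 1 - ⌈c - r⌉).toNat : ℝ) = max ((⌊c + r⌋ : ℝ) + 1 - ⌈c - r⌉) 0 := by
    rw [← Int.cast_natCast, Int.toNat_eq_max]; push_cast; rfl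
  rw [h2]
  refine max_le ?_ (by linarith)
  linarith [Int.floor_le (c + r), Int.le_ceil (c - r)]

theorem card_filter_abs_abs_sub_le (A : Finset ℤ) (c : ℝ) {r : ℝ} (hr : 0 ≤ r) :
    ((A.filter fun y : ℤ => |(|(y : ℝ)| - c)| ≤ r).card : ℝ) ≤ 4 * r + 2 := by
  have hsub : (A.filter fun y : ℤ => |(|(y : ℝ)| - c)| ≤ r) ⊆
      (A.filter fun y : ℤ => |(y : ℝ) - c| ≤ r) ∪ (A.filter fun y : ℤ => |(y : ℝ) - -c| ≤ r) := by
    intro y hy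
    simp only [Finset.mem_union, Finset.mem_filter] at hy ⊢
    rcases le_total 0 (y : ℝ) with h | h
    · left; rw [abs_of_nonneg h] at hy; exact hy
    · right; rw [abs_of_nonpos h] at hy
      refine ⟨hy.1, ?_⟩
      rw [← abs_neg]; convert hy.2 using 2; ring
  have h1 := (Finset.card_le_card hsub).trans (Finset.card_union_le _ _)
  have h2 := card_filter_abs_sub_le A c hr
  have h3 := card_filter_abs_sub_le A (-c) hr
  have h4 : ((A.filter fun y : ℤ => |(|(y : ℝ)| - c)| ≤ r).card : ℝ) ≤
      (A.filter fun y : ℤ => |(y : ℝ) - c| ≤ r).card +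
      (A.filter fun y : ℤ => |(y : ℝ) - -c| ≤ r).card := by exact_mod_cast h1
  linarith

/-- For fixed `x`, few integers `y` have `y ^ k` close to `x ^ k`. -/
theorem card_filter_pow_sub_le {k : ℕ} (hk : 2 ≤ k) (A : Finset ℤ) (x : ℤ) {B D : ℝ}
    (hD : 0 ≤ D) (hBD : B ^ 2 ≤ D ^ k) :
    ((A.filter fun y : ℤ => |(x : ℝ) ^ k - (y : ℝ) ^ k| ≤ B).card : ℝ) ≤
      if x = 0 then D + 2 else 4 * (D / |(x : ℝ)|) + 2 := by
  have key : ∀ y : ℤ, |(x : ℝ) ^ k - (y : ℝ) ^ k| ≤ B →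
      |(|(y : ℝ)| - |(x : ℝ)|)| * |(x : ℝ)| ≤ D ∧ |(|(y : ℝ)| - |(x : ℝ)|)| * |(y : ℝ)| ≤ D := by
    intro y hy
    refine abs_sub_mul_le hk (abs_nonneg _) (abs_nonneg _) hD hBD ?_
    rw [← abs_pow, ← abs_pow]
    exact (abs_abs_sub_abs_le_abs_sub _ _).trans hy
  split_ifs with hx
  · subst hx
    have hsub : (A.filter fun y : ℤ => |((0 : ℤ) : ℝ) ^ k - (y : ℝ) ^ k| ≤ B) ⊆
        A.filter fun y : ℤ => |(y : ℝ) - 0| ≤ (1 + D) / 2 := by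
      intro y hy
      rw [Finset.mem_filter] at hy ⊢
      refine ⟨hy.1, ?_⟩
      have h1 := (key y hy.2).2
      simp only [Int.cast_zero, abs_zero, sub_zero, abs_abs] at h1 ⊢
      nlinarith [sq_nonneg (|(y : ℝ)| - 1)]
    have h1 : ((A.filter fun y : ℤ => |((0 : ℤ) : ℝ) ^ k - (y : ℝ) ^ k| ≤ B).card : ℝ) ≤
      (A.filter fun y : ℤ => |(y : ℝ) - 0| ≤ (1 + D) / 2).card := by
        exact_mod_cast Finset.card_le_card hsub
    have := card_filter_abs_sub_le A 0 (r := (1 + D) / 2) (by positivity)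
    exact h1.trans (this.trans (by linarith))
  · have hx' : 0 < |(x : ℝ)| := abs_pos.2 (by exact_mod_cast hx)
    have hsub : (A.filter fun y : ℤ => |(x : ℝ) ^ k - (y : ℝ) ^ k| ≤ B) ⊆
        A.filter fun y : ℤ => |(|(y : ℝ)| - |(x : ℝ)|)| ≤ D / |(x : ℝ)| := by
      intro y hy
      rw [Finset.mem_filter] at hy ⊢
      refine ⟨hy.1, ?_⟩
      rw [le_div_iff₀ hx']
      exact (key y hy.2).1
    have h1 : ((A.filter fun y : ℤ => |(x : ℝ) ^ k - (y : ℝ) ^ k| ≤ B).card : ℝ) ≤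
      (A.filter fun y : ℤ => |(|(y : ℝ)| - |(x : ℝ)|)| ≤ D / |(x : ℝ)|).card := by
        exact_mod_cast Finset.card_le_card hsub
    exact h1.trans (card_filter_abs_abs_sub_le A _ (by positivity))

theorem sum_ite_div_abs_le (N : ℕ) (D : ℝ) :
    (∑ x ∈ Finset.Icc (-(N : ℤ)) N, if x = 0 then D + 2 else 4 * (D / |(x : ℝ)|) + 2) ≤
      8 * D * (harmonic N : ℚ) + D + 4 * N + 2 := by
  induction N with
  | zero => simp
  | succ n ih =>
    push_cast
    rw [Finset.sum_Icc_succ_eq_add_endpoints, harmonic_succ]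
    have h1 : (n : ℤ) + 1 ≠ 0 := by omega
    have h2 : -((n : ℤ) + 1) ≠ 0 := by omega
    rw [if_neg h1, if_neg h2]
    push_cast
    rw [abs_neg, abs_of_nonneg (by positivity : (0 : ℝ) ≤ (n : ℝ) + 1), div_eq_mul_inv]
    linarith

theorem sum_tent_le {k : ℕ} (hk : 2 ≤ k) (N : ℕ) {η α D : ℝ} (hη : 0 < η) (hα : α ≠ 0)
    (hD : 0 ≤ D) (hBD : (η / |α|) ^ 2 ≤ D ^ k) :
    ∑ x ∈ Finset.Icc (-(N : ℤ)) N, ∑ y ∈ Finset.Icc (-(N : ℤ)) N,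
        tent η (α * ((x : ℝ) ^ k - (y : ℝ) ^ k)) ≤
      8 * D * (1 + Real.log N) + D + 4 * N + 2 := by
  have hα' : 0 < |α| := abs_pos.2 hα
  calc _ ≤ ∑ x ∈ Finset.Icc (-(N : ℤ)) N,
        if x = 0 then D + 2 else 4 * (D / |(x : ℝ)|) + 2 := by
        refine Finset.sum_le_sum fun x _ => ?_
        refine le_trans ?_ (card_filter_pow_sub_le hk (Finset.Icc (-(N : ℤ)) N) x hD hBD)
        rw [Finset.card_filter]
        push_cast
        refine Finset.sum_le_sum fun y _ => ?_
        split_ifs with h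
        · unfold tent
          refine max_le zero_le_one ?_
          have : 0 ≤ |α * ((x : ℝ) ^ k - (y : ℝ) ^ k)| / η := by positivity
          linarith
        · rw [tent_of_le hη]
          rw [not_le, div_lt_iff₀ hα'] at h
          rw [abs_mul, mul_comm]
          exact h.le
    _ ≤ 8 * D * (harmonic N : ℚ) + D + 4 * N + 2 := sum_ite_div_abs_le N D
    _ ≤ _ := by
      have := harmonic_le_one_add_log N
      gcongr

theorem norm_eF_sub_le (a b : ℝ) : ‖eF a - eF b‖ ≤ 2 * π * |a - b| := by
  have h1 : eF a - eF b = eF b * (Complex.exp (Complex.I * ((2 * π * (a - b) : ℝ) : ℂ)) - 1) := by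
    rw [mul_comm Complex.I, ← eF_def', mul_sub, ← eF_add, mul_one]
    congr 2; ring
  rw [h1, norm_mul, norm_eF, one_mul]
  refine Real.norm_exp_I_mul_ofReal_sub_one_le.trans ?_
  rw [Real.norm_eq_abs, abs_mul, abs_of_pos Real.two_pi_pos]

theorem norm_vInt_le (k : ℕ) {P : ℝ} (hP : 0 ≤ P) (β : ℝ) : ‖vInt k P β‖ ≤ 2 * P := by
  unfold vInt
  refine (intervalIntegral.norm_integral_le_of_norm_le_const (C := 1)
    fun x _ => (norm_eF _).le).trans ?_
  rw [abs_of_nonneg (by linarith)]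
  linarith

theorem intervalIntegrable_eF_pow (k : ℕ) (β a b : ℝ) :
    IntervalIntegrable (fun ξ : ℝ => eF (β * ξ ^ k)) volume a b :=
  Continuous.intervalIntegrable (by fun_prop) _ _

theorem vInt_eq_add (k : ℕ) (β a b : ℝ) :
    vInt k b β = (∫ ξ in (-b)..(-a), eF (β * ξ ^ k)) + vInt k a β + ∫ ξ in a..b, eF (β * ξ ^ k) := by
  unfold vInt
  rw [intervalIntegral.integral_add_adjacent_intervals (intervalIntegrable_eF_pow ..)
      (intervalIntegrable_eF_pow ..),
    intervalIntegral.integral_add_adjacent_intervals (intervalIntegrable_eF_pow ..)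
      (intervalIntegrable_eF_pow ..)]

theorem norm_eF_sub_integral_le (k : ℕ) (β : ℝ) {a b c P : ℝ} (hab : b = a + 1)
    (hc : c = a ∨ c = b) (ha : -P ≤ a) (hb : b ≤ P) :
    ‖eF (β * c ^ k) - ∫ ξ in a..b, eF (β * ξ ^ k)‖ ≤ 2 * π * |β| * (k * P ^ (k - 1)) := by
  have hconst : eF (β * c ^ k) = ∫ ξ in a..b, eF (β * c ^ k) := by
    rw [intervalIntegral.integral_const, hab]; simp
  rw [hconst, ← intervalIntegral.integral_sub (by simp) (intervalIntegrable_eF_pow ..)]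
  refine (intervalIntegral.norm_integral_le_of_norm_le_const
    (C := 2 * π * |β| * (k * P ^ (k - 1))) fun x hx => ?_).trans (by rw [hab]; simp)
  rw [uIoc_of_le (by linarith)] at hx
  refine (norm_eF_sub_le _ _).trans ?_
  rw [← mul_sub, abs_mul, ← mul_assoc]
  have h1 := abs_pow_sub_pow_le c x k
  have hcx : |c - x| ≤ 1 := by
    rw [abs_le]; rcases hc with rfl | rfl <;> constructor <;> linarith [hx.1, hx.2]
  have hmax : max |c| |x| ≤ P := by
    refine max_le (abs_le.2 ?_) (abs_le.2 ⟨by linarith [hx.1], by linarith [hx.2]⟩)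
    rcases hc with rfl | rfl <;> constructor <;> linarith
  have h2 : max |c| |x| ^ (k - 1) ≤ P ^ (k - 1) :=
    pow_le_pow_left₀ (le_max_of_le_left (abs_nonneg _)) hmax _
  have h3 : |c ^ k - x ^ k| ≤ k * P ^ (k - 1) := by
    refine h1.trans ?_
    calc |c - x| * k * max |c| |x| ^ (k - 1) ≤ 1 * k * P ^ (k - 1) := by gcongr
      _ = _ := by ring
  gcongr

theorem norm_weylSum_sub_vInt_natCast_le (k : ℕ) (β P : ℝ) (n : ℕ) (hn : (n : ℝ) ≤ P) :
    ‖weylSum k n β - vInt k n β‖ ≤ 1 + n * (2 * (2 * π * |β| * (k * P ^ (k - 1)))) := by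
  induction n with
  | zero => simp [weylSum, vInt, norm_eF]
  | succ n ih =>
    push_cast at hn
    specialize ih (by linarith)
    have h1 : weylSum k (n + 1) β = eF (β * ((n : ℝ) + 1) ^ k) + eF (β * (-((n : ℝ) + 1)) ^ k)
        + weylSum k n β := by
      unfold weylSum
      push_cast
      rw [Finset.sum_Icc_succ_eq_add_endpoints]
      push_cast
      rfl
    have h2 := vInt_eq_add k β n ((n + 1 : ℕ) : ℝ)
    have h3 := norm_eF_sub_integral_le k β (a := n) (b := (n + 1 : ℕ)) (c := n + 1) (P := P)
      (by push_cast; rfl) (by right; push_cast; rfl) (by linarith [(Nat.cast_nonneg n : (0 : ℝ) ≤ n)])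
      (by push_cast; linarith)
    have h4 := norm_eF_sub_integral_le k β (a := -((n + 1 : ℕ) : ℝ)) (b := -n)
      (c := -((n : ℝ) + 1)) (P := P)
      (by push_cast; ring) (by left; push_cast; rfl) (by push_cast; linarith)
      (by linarith [(Nat.cast_nonneg n : (0 : ℝ) ≤ n)])
    rw [h1, h2]
    set A := eF (β * ((n : ℝ) + 1) ^ k)
    set B := eF (β * (-((n : ℝ) + 1)) ^ k)
    set I1 := ∫ ξ in (-((n + 1 : ℕ) : ℝ))..(-n), eF (β * ξ ^ k)
    set I2 := ∫ ξ in (n : ℝ)..((n + 1 : ℕ) : ℝ), eF (β * ξ ^ k)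
    have h5 : A + B + weylSum k n β - (I1 + vInt k n β + I2) =
        (weylSum k n β - vInt k n β) + (A - I2) + (B - I1) := by ring
    rw [h5]
    refine (norm_add₃_le).trans ?_
    push_cast
    linarith

/-- Comparison of the exponential sum with the exponential integral. -/
theorem norm_weylSum_sub_vInt_le {k : ℕ} (hk : 1 ≤ k) (β : ℝ) {P : ℝ} (hP : 0 ≤ P) :
    ‖weylSum k ⌊P⌋₊ β - vInt k P β‖ ≤ 3 + 4 * π * k * |β| * P ^ k := by
  have hfl := Nat.floor_le hP
  have hfl2 := (Nat.lt_floor_add_one P).le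
  have h1 := norm_weylSum_sub_vInt_natCast_le k β P _ hfl
  have h2 := vInt_eq_add k β ⌊P⌋₊ P
  have b1 : ‖∫ ξ in (-P)..(-(⌊P⌋₊ : ℝ)), eF (β * ξ ^ k)‖ ≤ 1 := by
    refine (intervalIntegral.norm_integral_le_of_norm_le_const (C := 1)
      fun x _ => (norm_eF _).le).trans ?_
    rw [one_mul, abs_le]; constructor <;> linarith
  have b2 : ‖∫ ξ in (⌊P⌋₊ : ℝ)..P, eF (β * ξ ^ k)‖ ≤ 1 := by
    refine (intervalIntegral.norm_integral_le_of_norm_le_const (C := 1)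
      fun x _ => (norm_eF _).le).trans ?_
    rw [one_mul, abs_le]; constructor <;> linarith
  rw [h2]
  set I1 := ∫ ξ in (-P)..(-(⌊P⌋₊ : ℝ)), eF (β * ξ ^ k)
  set I2 := ∫ ξ in (⌊P⌋₊ : ℝ)..P, eF (β * ξ ^ k)
  have h5 : weylSum k ⌊P⌋₊ β - (I1 + vInt k ⌊P⌋₊ β + I2) =
      (weylSum k ⌊P⌋₊ β - vInt k ⌊P⌋₊ β) + -I1 + -I2 := by ring
  rw [h5]
  refine (norm_add₃_le).trans ?_
  rw [norm_neg, norm_neg]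
  have h6 : (⌊P⌋₊ : ℝ) * (2 * (2 * π * |β| * (k * P ^ (k - 1)))) ≤
      P * (2 * (2 * π * |β| * (k * P ^ (k - 1)))) := by gcongr
  have h7 : P ^ k = P * P ^ (k - 1) := by
    rw [← pow_succ', Nat.sub_add_cancel hk]
  rw [h7]
  linarith

theorem norm_integral_eF_pow_le {k : ℕ} (hk : 2 ≤ k) {β X P : ℝ} (hβ : β ≠ 0) (hX : 0 < X)
    (hXP : X ≤ P) : ‖∫ ξ in X..P, eF (β * ξ ^ k)‖ ≤ 1 / (|β| * X ^ (k - 1)) := by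
  obtain ⟨j, rfl⟩ := Nat.exists_eq_add_of_le' hk
  have hpos : ∀ x ∈ uIcc X P, 0 < x := fun x hx => by
    rw [uIcc_of_le hXP] at hx; exact hX.trans_le hx.1
  set c : ℂ := 2 * π * Complex.I * β * ((j : ℂ) + 2) with hc
  have hnc : ‖c‖ = 2 * π * |β| * (j + 2) := by
    have : c = ((2 * π * β * ((j : ℝ) + 2) : ℝ) : ℂ) * Complex.I := by rw [hc]; push_cast; ring
    rw [this, norm_mul, Complex.norm_I, mul_one, Complex.norm_real, Real.norm_eq_abs, abs_mul,
      abs_mul, abs_of_pos Real.two_pi_pos, abs_of_pos (by positivity : (0 : ℝ) < (j : ℝ) + 2)]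
  have hncpos : 0 < ‖c‖ := by
    rw [hnc]
    have := abs_pos.2 hβ
    positivity
  have hc0 : c ≠ 0 := norm_pos_iff.1 hncpos
  let g : ℝ → ℝ := fun x => ((j : ℝ) + 1) * x ^ j / (x ^ (j + 1)) ^ 2
  have hg : ∀ x ∈ uIcc X P, HasDerivAt (fun x : ℝ => -(x ^ (j + 1))⁻¹) (g x) x := by
    intro x hx
    have h := ((hasDerivAt_pow (j + 1) x).inv (pow_pos (hpos x hx) _).ne').neg
    refine h.congr_deriv ?_
    simp only [g]; push_cast; ring_nf
  have hgc : ContinuousOn g (uIcc X P) := by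
    refine ContinuousOn.div (by fun_prop) (by fun_prop) fun x hx => ?_
    exact pow_ne_zero _ (pow_pos (hpos x hx) _).ne'
  have hgi : IntervalIntegrable g volume X P := hgc.intervalIntegrable
  have hgint := intervalIntegral.integral_eq_sub_of_hasDerivAt hg hgi
  let F : ℝ → ℂ := fun x => eF (β * x ^ (j + 2)) * (((-(x ^ (j + 1))⁻¹ : ℝ)) : ℂ) / c
  have hF : ∀ x ∈ uIcc X P, HasDerivAt F
      (-eF (β * x ^ (j + 2)) + eF (β * x ^ (j + 2)) * (g x : ℂ) / c) x := by
    intro x hx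
    have hx0 : (x : ℂ) ≠ 0 := by exact_mod_cast (hpos x hx).ne'
    have h1 : HasDerivAt (fun x : ℝ => ((β * x ^ (j + 2) : ℝ) : ℂ))
        ((β * (((j + 2 : ℕ) : ℝ) * x ^ (j + 1)) : ℝ) : ℂ) x :=
      ((hasDerivAt_pow (j + 2) x).const_mul β).ofReal_comp
    have h2 : HasDerivAt (fun x : ℝ => eF (β * x ^ (j + 2)))
        (eF (β * x ^ (j + 2)) * (c * x ^ (j + 1))) x := by
      have := (h1.const_mul (2 * (π : ℂ) * Complex.I)).cexp
      refine this.congr_deriv ?_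
      rw [eF, hc]; push_cast; ring
    refine ((h2.mul (hg x hx).ofReal_comp).div_const c).congr_deriv ?_
    push_cast
    field_simp
  have hci : IntervalIntegrable (fun x : ℝ => eF (β * x ^ (j + 2)) * (g x : ℂ) / c)
      volume X P := by
    refine ContinuousOn.intervalIntegrable ?_
    refine ContinuousOn.div_const (ContinuousOn.mul (by fun_prop) ?_) _
    exact Complex.continuous_ofReal.comp_continuousOn hgc
  have hFint := intervalIntegral.integral_eq_sub_of_hasDerivAt hF
    ((intervalIntegrable_eF_pow ..).neg.add hci)
  have hni : IntervalIntegrable (fun x : ℝ => -eF (β * x ^ (j + 2))) volume X P :=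
    (intervalIntegrable_eF_pow ..).neg
  rw [intervalIntegral.integral_add hni hci, intervalIntegral.integral_neg] at hFint
  have hmain : ∫ x in X..P, eF (β * x ^ (j + 2)) =
      (∫ x in X..P, eF (β * x ^ (j + 2)) * (g x : ℂ) / c) + F X + -F P := by
    linear_combination -hFint
  have hP : 0 < P := hX.trans_le hXP
  have hFn : ∀ x, 0 < x → ‖F x‖ = (x ^ (j + 1))⁻¹ / ‖c‖ := by
    intro x hx
    simp only [F]
    rw [norm_div, norm_mul, norm_eF, one_mul, Complex.norm_real, norm_neg, Real.norm_of_nonneg]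
    positivity
  have hI : ‖∫ x in X..P, eF (β * x ^ (j + 2)) * (g x : ℂ) / c‖ ≤ (X ^ (j + 1))⁻¹ / ‖c‖ := by
    have h1 : ‖∫ x in X..P, eF (β * x ^ (j + 2)) * (g x : ℂ) / c‖ ≤ ∫ x in X..P, g x / ‖c‖ := by
      refine intervalIntegral.norm_integral_le_of_norm_le hXP (ae_of_all _ fun x hx => ?_)
        (hgi.div_const _)
      rw [norm_div, norm_mul, norm_eF, one_mul, Complex.norm_real, Real.norm_of_nonneg]
      have : 0 < x := hX.trans hx.1
      simp only [g]; positivity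
    refine h1.trans ?_
    rw [intervalIntegral.integral_div, hgint]
    have : 0 ≤ (P ^ (j + 1))⁻¹ := by positivity
    gcongr
    linarith
  have hXP' : (P ^ (j + 1))⁻¹ / ‖c‖ ≤ (X ^ (j + 1))⁻¹ / ‖c‖ := by gcongr
  have htot : ‖∫ ξ in X..P, eF (β * ξ ^ (j + 2))‖ ≤ 3 * ((X ^ (j + 1))⁻¹ / ‖c‖) := by
    rw [hmain]
    refine norm_add₃_le.trans ?_
    rw [norm_neg, hFn X hX, hFn P hP]
    linarith
  refine htot.trans ?_
  have hβ' := abs_pos.2 hβ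
  have he : j + 2 - 1 = j + 1 := rfl
  rw [he, one_div, mul_inv, hnc]
  have h3 : 3 ≤ 2 * π * ((j : ℝ) + 2) := by
    have := Real.pi_gt_three
    have hj : (0 : ℝ) ≤ j := Nat.cast_nonneg j
    nlinarith
  have : 3 * ((X ^ (j + 1))⁻¹ / (2 * π * |β| * (j + 2))) =
      (|β|⁻¹ * (X ^ (j + 1))⁻¹) * (3 / (2 * π * ((j : ℝ) + 2))) := by field_simp
  rw [this]
  refine mul_le_of_le_one_right (by positivity) ?_
  rw [div_le_one (by positivity)]
  exact h3

/-- The van der Corput bound for the exponential integral. -/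
theorem norm_vInt_le_of_pow {k : ℕ} (hk : 2 ≤ k) {β X P : ℝ} (hX : 0 < X) (hP : 0 ≤ P)
    (h : |β| * X ^ k = 1) : ‖vInt k P β‖ ≤ 4 * X := by
  have hβ : β ≠ 0 := by rintro rfl; simp at h
  rcases le_or_gt P X with hPX | hXP
  · exact (norm_vInt_le k hP β).trans (by linarith)
  have hbd : ∀ β' : ℝ, |β'| = |β| → ‖∫ ξ in X..P, eF (β' * ξ ^ k)‖ ≤ X := by
    intro β' hβ'
    have hb0 : β' ≠ 0 := by rw [← abs_pos, hβ']; exact abs_pos.2 hβ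
    refine (norm_integral_eF_pow_le hk hb0 hX hXP.le).trans ?_
    rw [hβ', div_le_iff₀ (mul_pos (abs_pos.2 hβ) (pow_pos hX _)), ← h]
    rw [← Nat.sub_add_cancel (by omega : 1 ≤ k), pow_succ]
    simp only [Nat.add_sub_cancel]
    exact le_of_eq (by ring)
  have hneg : ∫ ξ in (-P)..(-X), eF (β * ξ ^ k) = ∫ ξ in X..P, eF ((β * (-1) ^ k) * ξ ^ k) := by
    rw [← intervalIntegral.integral_comp_neg]
    refine intervalIntegral.integral_congr fun ξ _ => ?_
    rw [neg_pow]; congr 1; ring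
  rw [vInt_eq_add k β X P, hneg]
  refine norm_add₃_le.trans ?_
  have h1 := hbd β rfl
  have h2 := hbd (β * (-1) ^ k) (by rw [abs_mul, abs_pow]; simp)
  have h3 := norm_vInt_le k hX.le β
  linarith

/-- The range `1/C ≤ |t| ≤ C` of each coefficient. -/
def coeffRange (C : ℝ) : Set ℝ := {t | 1 / C ≤ |t| ∧ |t| ≤ C}

theorem isClosed_coeffRange (C : ℝ) : IsClosed (coeffRange C) := by
  have h1 : IsClosed {t : ℝ | 1 / C ≤ |t|} := isClosed_le (by fun_prop) (by fun_prop)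
  have h2 : IsClosed {t : ℝ | |t| ≤ C} := isClosed_le (by fun_prop) (by fun_prop)
  exact h1.inter h2

theorem coeffRange_subset (C : ℝ) : coeffRange C ⊆ Icc (-C) C := fun _ ht => abs_le.1 ht.2

theorem isCompact_coeffRange (C : ℝ) : IsCompact (coeffRange C) :=
  isCompact_Icc.of_isClosed_subset (isClosed_coeffRange C) (coeffRange_subset C)

theorem volume_coeffRange_le (C : ℝ) : volume (coeffRange C) ≤ ENNReal.ofReal (2 * C) := by
  refine (measure_mono (coeffRange_subset C)).trans ?_
  rw [Real.volume_Icc]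
  exact ENNReal.ofReal_le_ofReal (by linarith)

theorem volumeReal_coeffRange_le {C : ℝ} (hC : 0 ≤ C) : volume.real (coeffRange C) ≤ 2 * C :=
  ENNReal.toReal_le_of_le_ofReal (by linarith) (volume_coeffRange_le C)

theorem one_le_mul_sincSq {C t : ℝ} (hC : 0 < C) (ht : t ≠ 0) (htC : |t| ≤ C) :
    1 ≤ (2 * C * (π / 2) ^ 2) * sincSq (1 / (2 * C)) t := by
  have hpi := Real.pi_pos
  set u : ℝ := π * (1 / (2 * C)) * t with hu
  have hu0 : u ≠ 0 := by rw [hu]; positivity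
  have habs : |u| = π * (1 / (2 * C)) * |t| := by
    rw [hu, abs_mul, abs_of_pos (by positivity)]
  have hule : |u| ≤ π / 2 := by
    rw [habs]
    calc π * (1 / (2 * C)) * |t| ≤ π * (1 / (2 * C)) * C := by gcongr
      _ = π / 2 := by field_simp
  have h1 : 2 / π ≤ |Real.sin u / u| := by
    have h2 := Real.mul_le_sin (abs_nonneg u) hule
    have h3 : |Real.sin u| = Real.sin |u| := by
      rw [Real.abs_sin_eq_sin_abs_of_abs_le_pi (by linarith)]
    rw [abs_div, h3, le_div_iff₀ (abs_pos.2 hu0)]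
    exact h2
  have h4 : (2 / π) ^ 2 ≤ (Real.sin u / u) ^ 2 := by
    rw [← sq_abs (Real.sin u / u)]
    gcongr
  have h5 : sincSq (1 / (2 * C)) t = 1 / (2 * C) * (Real.sin u / u) ^ 2 := rfl
  rw [h5]
  calc (1 : ℝ) = 2 * C * (π / 2) ^ 2 * (1 / (2 * C) * (2 / π) ^ 2) := by field_simp
    _ ≤ _ := by gcongr

theorem integral_coeffRange_normSq_weylSum_le {k : ℕ} (hk : 2 ≤ k) {C : ℝ} (hC : 2 ≤ C) (N : ℕ)
    {α Y : ℝ} (hα : α ≠ 0) (hYk : Y ^ k = |α|⁻¹) :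
    ∫ t in coeffRange C, ‖weylSum k N (t * α)‖ ^ 2 ≤
      (2 * C * (π / 2) ^ 2) * (8 * Y ^ 2 * (1 + Real.log N) + Y ^ 2 + 4 * N + 2) := by
  have hη : 0 < 1 / (2 * C) := by positivity
  have hcont : Continuous fun t => ‖weylSum k N (t * α)‖ ^ 2 := by fun_prop
  have hint : Integrable fun t => sincSq (1 / (2 * C)) t * ‖weylSum k N (t * α)‖ ^ 2 := by
    refine (integrable_sincSq hη).mul_bdd (c := (2 * N + 1) ^ 2)
      hcont.aestronglyMeasurable (ae_of_all _ fun t => ?_)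
    rw [Real.norm_of_nonneg (by positivity)]
    have := norm_weylSum_le k N (t * α)
    gcongr
  have h1 : ∫ t in coeffRange C, ‖weylSum k N (t * α)‖ ^ 2 ≤ ∫ t in coeffRange C,
      (2 * C * (π / 2) ^ 2) * (sincSq (1 / (2 * C)) t * ‖weylSum k N (t * α)‖ ^ 2) := by
    refine setIntegral_mono_on (hcont.continuousOn.integrableOn_compact (isCompact_coeffRange C))
      (hint.const_mul _).integrableOn (isClosed_coeffRange C).measurableSet fun t ht => ?_
    have ht0 : t ≠ 0 := by
      rintro rfl
      have h0 := ht.1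
      rw [abs_zero] at h0
      have : 0 < 1 / C := by positivity
      linarith
    have := one_le_mul_sincSq (by linarith) ht0 ht.2
    calc ‖weylSum k N (t * α)‖ ^ 2 = 1 * ‖weylSum k N (t * α)‖ ^ 2 := by ring
      _ ≤ (2 * C * (π / 2) ^ 2 * sincSq (1 / (2 * C)) t) * ‖weylSum k N (t * α)‖ ^ 2 := by gcongr
      _ = _ := by ring
  refine h1.trans ?_
  rw [integral_const_mul]
  have h2 : ∫ t in coeffRange C, sincSq (1 / (2 * C)) t * ‖weylSum k N (t * α)‖ ^ 2 ≤
      ∫ t, sincSq (1 / (2 * C)) t * ‖weylSum k N (t * α)‖ ^ 2 :=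
    setIntegral_le_integral hint (ae_of_all _ fun t => mul_nonneg (sincSq_nonneg hη t) (by positivity))
  have h3 := integral_normSq_weylSum k N α hη
  rw [integral_dEta hη] at h3
  simp only [smul_eq_mul] at h3
  rw [h3] at h2
  have h4 := sum_tent_le hk N hη hα (sq_nonneg Y) (by
    rw [← pow_mul, mul_comm 2 k, pow_mul, hYk, ← one_div]
    have : 1 / (2 * C) ≤ 1 := by rw [div_le_one (by linarith)]; linarith
    gcongr)
  have h5 := h2.trans h4
  gcongr

/-- Mean value of the exponential sum over the coefficient. -/
theorem exists_integral_norm_weylSum_le {k : ℕ} (hk : 2 ≤ k) {C κ : ℝ} (hC : 2 ≤ C)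
    (hκ : 0 < κ) : ∃ c : ℝ, 0 < c ∧ ∀ P : ℝ, 2 ≤ P → ∀ α Y : ℝ, α ≠ 0 → Y ^ k = |α|⁻¹ → 0 ≤ Y →
      ∫ t in coeffRange C, ‖weylSum k ⌊P⌋₊ (t * α)‖ ≤ c * (P ^ (1 / 2 : ℝ) + Y * P ^ κ) := by
  set K : ℝ := 2 * C * (π / 2) ^ 2 with hK
  have hpi := Real.pi_pos
  have hKpos : 0 < K := by positivity
  set c₁ : ℝ := 9 * (1 + 1 / (2 * κ)) with hc₁
  have hc₁9 : 9 ≤ c₁ := by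
    have : 0 < 1 / (2 * κ) := by positivity
    linarith
  refine ⟨(K * c₁ + 2 * C) / 2, by positivity, fun P hP α Y hα hYk hY => ?_⟩
  set R : ℝ := P ^ (1 / 2 : ℝ) + Y * P ^ κ with hR
  have hP0 : 0 < P := by linarith
  have hRpos : 0 < R := by positivity
  have hN : (⌊P⌋₊ : ℝ) ≤ P := Nat.floor_le hP0.le
  have hN1 : 1 ≤ ⌊P⌋₊ := Nat.one_le_floor_iff _ |>.2 (by linarith)
  have hlog : 1 + Real.log ⌊P⌋₊ ≤ (1 + 1 / (2 * κ)) * P ^ (2 * κ) := by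
    have h1 : Real.log ⌊P⌋₊ ≤ Real.log P :=
      Real.log_le_log (by exact_mod_cast hN1) hN
    have h2 := Real.log_le_rpow_div hP0.le (ε := 2 * κ) (by linarith)
    have h3 : 1 ≤ P ^ (2 * κ) := Real.one_le_rpow (by linarith) (by linarith)
    have h4 : (1 + 1 / (2 * κ)) * P ^ (2 * κ) = P ^ (2 * κ) + P ^ (2 * κ) / (2 * κ) := by ring
    linarith
  have hPκ : P ^ (2 * κ) = (P ^ κ) ^ 2 := by
    rw [← Real.rpow_natCast, ← Real.rpow_mul hP0.le]; congr 1; push_cast; ring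
  have hPh : (P ^ (1 / 2 : ℝ)) ^ 2 = P := by
    rw [← Real.rpow_natCast, ← Real.rpow_mul hP0.le]; norm_num
  have hsq : ∫ t in coeffRange C, ‖weylSum k ⌊P⌋₊ (t * α)‖ ^ 2 ≤ K * (c₁ * R ^ 2) := by
    refine (integral_coeffRange_normSq_weylSum_le hk hC ⌊P⌋₊ hα hYk).trans ?_
    refine mul_le_mul_of_nonneg_left ?_ hKpos.le
    have h1 : 8 * Y ^ 2 * (1 + Real.log ⌊P⌋₊) ≤
        8 * Y ^ 2 * ((1 + 1 / (2 * κ)) * P ^ (2 * κ)) := by gcongr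
    have h2 : Y ^ 2 ≤ Y ^ 2 * ((1 + 1 / (2 * κ)) * P ^ (2 * κ)) := by
      refine le_mul_of_one_le_right (sq_nonneg _) (le_trans ?_ hlog)
      have := Real.log_nonneg (show (1 : ℝ) ≤ ⌊P⌋₊ by exact_mod_cast hN1)
      linarith
    have h3 : 8 * Y ^ 2 * ((1 + 1 / (2 * κ)) * P ^ (2 * κ)) +
        Y ^ 2 * ((1 + 1 / (2 * κ)) * P ^ (2 * κ)) = c₁ * (Y * P ^ κ) ^ 2 := by
      rw [hPκ, hc₁]; ring
    have h4 : (P ^ (1 / 2 : ℝ)) ^ 2 + (Y * P ^ κ) ^ 2 ≤ R ^ 2 := by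
      rw [hR]
      have : 0 ≤ P ^ (1 / 2 : ℝ) * (Y * P ^ κ) := by positivity
      nlinarith
    rw [hPh] at h4
    have h5 : c₁ * (P + (Y * P ^ κ) ^ 2) ≤ c₁ * R ^ 2 := by gcongr
    have h6 : 9 * P ≤ c₁ * P := by gcongr
    nlinarith
  have hcont : Continuous fun t => ‖weylSum k ⌊P⌋₊ (t * α)‖ := by fun_prop
  have hcomp := isCompact_coeffRange C
  have hi1 : IntegrableOn (fun t => ‖weylSum k ⌊P⌋₊ (t * α)‖ ^ 2 / R / 2) (coeffRange C) :=
    (Continuous.continuousOn (by fun_prop)).integrableOn_compact hcomp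
  have hi2 : IntegrableOn (fun _ : ℝ => R / 2) (coeffRange C) :=
    continuousOn_const.integrableOn_compact hcomp
  calc ∫ t in coeffRange C, ‖weylSum k ⌊P⌋₊ (t * α)‖
      ≤ ∫ t in coeffRange C, (‖weylSum k ⌊P⌋₊ (t * α)‖ ^ 2 / R / 2 + R / 2) := by
        refine setIntegral_mono (hcont.continuousOn.integrableOn_compact hcomp)
          (hi1.add hi2) fun t => ?_
        have h1 : ‖weylSum k ⌊P⌋₊ (t * α)‖ ^ 2 / R / 2 + R / 2 - ‖weylSum k ⌊P⌋₊ (t * α)‖ =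
            (‖weylSum k ⌊P⌋₊ (t * α)‖ - R) ^ 2 / R / 2 := by field_simp; ring
        have h2 : 0 ≤ (‖weylSum k ⌊P⌋₊ (t * α)‖ - R) ^ 2 / R / 2 := by positivity
        simp only
        linarith
    _ = (∫ t in coeffRange C, ‖weylSum k ⌊P⌋₊ (t * α)‖ ^ 2) / R / 2 +
          volume.real (coeffRange C) * (R / 2) := by
        rw [integral_add hi1 hi2, integral_div, integral_div, setIntegral_const, smul_eq_mul]
    _ ≤ K * (c₁ * R ^ 2) / R / 2 + 2 * C * (R / 2) := by
        have := volumeReal_coeffRange_le (show 0 ≤ C by linarith)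
        gcongr
    _ = (K * c₁ + 2 * C) / 2 * R := by field_simp

@[fun_prop]
theorem continuous_vInt (k : ℕ) (P : ℝ) : Continuous (vInt k P) := by
  unfold vInt
  exact intervalIntegral.continuous_parametric_intervalIntegral_of_continuous' (by fun_prop) _ _

theorem integral_norm_vInt_le {k : ℕ} (hk : 2 ≤ k) {C P α Y : ℝ} (hC : 1 ≤ C) (hP : 0 ≤ P)
    (hα : α ≠ 0) (hYk : Y ^ k = |α|⁻¹) (hY : 0 ≤ Y) :
    ∫ t in coeffRange C, ‖vInt k P (t * α)‖ ≤ 8 * C ^ 2 * Y := by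
  have hα' := abs_pos.2 hα
  have hcomp := isCompact_coeffRange C
  have hcont : Continuous fun t => ‖vInt k P (t * α)‖ := by fun_prop
  have hbd : ∀ t ∈ coeffRange C, ‖vInt k P (t * α)‖ ≤ 4 * C * Y := by
    intro t ht
    have hC0 : 0 < 1 / C := by positivity
    have htpos : 0 < |t| := hC0.trans_le ht.1
    set z : ℝ := (|t|⁻¹) ^ ((k : ℝ)⁻¹) with hz
    have hzk : z ^ k = |t|⁻¹ := Real.rpow_inv_natCast_pow (by positivity) (by omega)
    have hz0 : 0 < z := by positivity
    have hYpos : 0 < Y := by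
      rcases hY.eq_or_lt with h | h
      · rw [← h, zero_pow (by omega)] at hYk
        have := inv_pos.2 hα'
        linarith
      · exact h
    have hzC : z ≤ C := by
      refine le_of_pow_le_pow_left₀ (n := k) (by omega) (by linarith) ?_
      rw [hzk]
      refine le_trans ?_ (le_self_pow₀ hC (by omega))
      rw [inv_le_comm₀ htpos (by linarith), ← one_div]
      exact ht.1
    have h1 := norm_vInt_le_of_pow (P := P) (β := t * α) hk (mul_pos hz0 hYpos) hP (by
      rw [abs_mul, mul_pow, hzk, hYk]; field_simp)
    refine h1.trans ?_
    rw [mul_assoc]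
    gcongr
  calc ∫ t in coeffRange C, ‖vInt k P (t * α)‖ ≤ ∫ t in coeffRange C, 4 * C * Y :=
        setIntegral_mono_on (hcont.continuousOn.integrableOn_compact hcomp)
          (continuousOn_const.integrableOn_compact hcomp)
          (isClosed_coeffRange C).measurableSet hbd
    _ = volume.real (coeffRange C) * (4 * C * Y) := by rw [setIntegral_const, smul_eq_mul]
    _ ≤ 2 * C * (4 * C * Y) := by
        have := volumeReal_coeffRange_le (show 0 ≤ C by linarith)
        gcongr
    _ = 8 * C ^ 2 * Y := by ring

/-- The box of all `λ` with `1/C ≤ |λ_j| ≤ C`. -/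
def coeffBox (s : ℕ) (C : ℝ) : Set (Fin s → ℝ) := univ.pi fun _ => coeffRange C

theorem lintegral_coeffBox_prod (s : ℕ) (C : ℝ) {g : ℝ → ℂ} (hg : Continuous g) :
    ∫⁻ l in coeffBox s C, ‖∏ j, g (l j)‖ₑ =
      ENNReal.ofReal ((∫ t in coeffRange C, ‖g t‖) ^ s) := by
  have hvol : (volume : Measure (Fin s → ℝ)).restrict (coeffBox s C) =
      Measure.pi fun _ : Fin s => (volume : Measure ℝ).restrict (coeffRange C) := by
    rw [coeffBox, volume_pi, Measure.restrict_pi_pi]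
  have hi : Integrable (fun l : Fin s → ℝ => ∏ j, ‖g (l j)‖)
      (Measure.pi fun _ : Fin s => (volume : Measure ℝ).restrict (coeffRange C)) :=
    Integrable.fintype_prod fun _ =>
      (hg.norm.continuousOn.integrableOn_compact (isCompact_coeffRange C))
  have h1 := integral_fintype_prod_eq_prod (ι := Fin s)
    (μ := fun _ => (volume : Measure ℝ).restrict (coeffRange C)) (fun _ t => ‖g t‖)
  rw [Finset.prod_const, Finset.card_univ, Fintype.card_fin] at h1
  rw [hvol, ← h1, ofReal_integral_eq_lintegral_ofReal hi
    (ae_of_all _ fun l => Finset.prod_nonneg fun _ _ => norm_nonneg _)]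
  refine lintegral_congr fun l => ?_
  rw [← norm_prod, ofReal_norm]

theorem volume_coeffBox_le (s : ℕ) (C : ℝ) :
    volume (coeffBox s C) ≤ ENNReal.ofReal (2 * C) ^ s := by
  rw [coeffBox, volume_pi_pi, Finset.prod_const, Finset.card_univ, Fintype.card_fin]
  exact pow_le_pow_left' (volume_coeffRange_le C) s

theorem measurableSet_coeffBox (s : ℕ) (C : ℝ) : MeasurableSet (coeffBox s C) :=
  MeasurableSet.univ_pi fun _ => (isClosed_coeffRange C).measurableSet

theorem norm_prod_sub_prod_mul_le {ι : Type*} (u : Finset ι) (a b : ι → ℂ) {M ε : ℝ}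
    (hM : 0 ≤ M) (ha : ∀ i ∈ u, ‖a i‖ ≤ M) (hb : ∀ i ∈ u, ‖b i‖ ≤ M)
    (hab : ∀ i ∈ u, ‖a i - b i‖ ≤ ε) :
    ‖∏ i ∈ u, a i - ∏ i ∈ u, b i‖ * M ≤ u.card * M ^ u.card * ε := by
  classical
  induction u using Finset.induction_on with
  | empty => simp
  | insert i u hi ih =>
    have ih' := ih (fun j hj => ha j (Finset.mem_insert_of_mem hj))
      (fun j hj => hb j (Finset.mem_insert_of_mem hj))
      (fun j hj => hab j (Finset.mem_insert_of_mem hj))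
    have h1 := ha i (Finset.mem_insert_self _ _)
    have h2 := hab i (Finset.mem_insert_self _ _)
    have h3 : ‖∏ j ∈ u, b j‖ ≤ M ^ u.card := by
      rw [norm_prod]
      refine (Finset.prod_le_prod (fun _ _ => norm_nonneg _)
        fun j hj => hb j (Finset.mem_insert_of_mem hj)).trans ?_
      rw [Finset.prod_const]
    rw [Finset.prod_insert hi, Finset.prod_insert hi, Finset.card_insert_of_notMem hi]
    have h4 : a i * ∏ j ∈ u, a j - b i * ∏ j ∈ u, b j =
        a i * (∏ j ∈ u, a j - ∏ j ∈ u, b j) + (a i - b i) * ∏ j ∈ u, b j := by ring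
    rw [h4]
    have h5 : ‖a i * (∏ j ∈ u, a j - ∏ j ∈ u, b j) + (a i - b i) * ∏ j ∈ u, b j‖ ≤
        M * ‖∏ j ∈ u, a j - ∏ j ∈ u, b j‖ + ε * M ^ u.card := by
      refine (norm_add_le _ _).trans ?_
      rw [norm_mul, norm_mul]
      have hε : 0 ≤ ε := (norm_nonneg _).trans h2
      gcongr
    calc _ ≤ (M * ‖∏ j ∈ u, a j - ∏ j ∈ u, b j‖ + ε * M ^ u.card) * M := by gcongr
      _ = M * (‖∏ j ∈ u, a j - ∏ j ∈ u, b j‖ * M) + ε * M ^ u.card * M := by ring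
      _ ≤ M * (u.card * M ^ u.card * ε) + ε * M ^ u.card * M := by gcongr
      _ = _ := by push_cast; ring

/-- The integrand `∏ f(λ_j α) − ∏ v(λ_j α)` whose integral is the error term. -/
noncomputable def prodDiff (k s : ℕ) (P : ℝ) (l : Fin s → ℝ) (α : ℝ) : ℂ :=
  ∏ j, weylSum k ⌊P⌋₊ (l j * α) - ∏ j, vInt k P (l j * α)

theorem continuous_prodDiff (k s : ℕ) (P : ℝ) :
    Continuous fun p : (Fin s → ℝ) × ℝ => prodDiff k s P p.1 p.2 := by
  unfold prodDiff
  have hf := continuous_weylSum k ⌊P⌋₊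
  have hv := continuous_vInt k P
  fun_prop

/-- The average of `|∏ f(λ_j α) − ∏ v(λ_j α)|` over the box of coefficients. -/
noncomputable def meanDiff (k s : ℕ) (C P α : ℝ) : ℝ≥0∞ :=
  ∫⁻ l in coeffBox s C, ‖prodDiff k s P l α‖ₑ

theorem exists_meanDiff_le {k : ℕ} (hk : 2 ≤ k) (s : ℕ) {C κ : ℝ} (hC : 2 ≤ C) (hκ : 0 < κ) :
    ∃ c : ℝ, 0 < c ∧ ∀ P : ℝ, 2 ≤ P → ∀ α Y : ℝ, α ≠ 0 → Y ^ k = |α|⁻¹ → 0 ≤ Y →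
      meanDiff k s C P α ≤
        ENNReal.ofReal (c * (P ^ (1 / 2 : ℝ) + Y * P ^ κ) ^ s) := by
  obtain ⟨c, hc, h⟩ := exists_integral_norm_weylSum_le hk hC hκ
  refine ⟨c ^ s + (8 * C ^ 2) ^ s, by positivity, fun P hP α Y hα hYk hY => ?_⟩
  have hP0 : 0 < P := by linarith
  set R : ℝ := P ^ (1 / 2 : ℝ) + Y * P ^ κ with hR
  have hRpos : 0 < R := by positivity
  have hYR : Y ≤ R := by
    have h1 : Y * 1 ≤ Y * P ^ κ :=
      mul_le_mul_of_nonneg_left (Real.one_le_rpow (by linarith) hκ.le) hY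
    have h2 : 0 ≤ P ^ (1 / 2 : ℝ) := by positivity
    linarith
  have hf := h P hP α Y hα hYk hY
  have hv := (integral_norm_vInt_le hk (by linarith : 1 ≤ C) hP0.le hα hYk hY).trans
    (mul_le_mul_of_nonneg_left hYR (by positivity))
  have e1 := lintegral_coeffBox_prod s C (g := fun t => weylSum k ⌊P⌋₊ (t * α)) (by fun_prop)
  have e2 := lintegral_coeffBox_prod s C (g := fun t => vInt k P (t * α)) (by fun_prop)
  calc meanDiff k s C P α
      ≤ ∫⁻ l in coeffBox s C, (‖∏ j, weylSum k ⌊P⌋₊ (l j * α)‖ₑ +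
          ‖∏ j, vInt k P (l j * α)‖ₑ) :=
        lintegral_mono fun l => enorm_sub_le
    _ = (∫⁻ l in coeffBox s C, ‖∏ j, weylSum k ⌊P⌋₊ (l j * α)‖ₑ) +
          ∫⁻ l in coeffBox s C, ‖∏ j, vInt k P (l j * α)‖ₑ := by
        refine lintegral_add_left (Continuous.measurable ?_) _
        fun_prop
    _ ≤ ENNReal.ofReal ((c * R) ^ s) + ENNReal.ofReal ((8 * C ^ 2 * R) ^ s) := by
        rw [e1, e2]
        have n1 : 0 ≤ ∫ t in coeffRange C, ‖weylSum k ⌊P⌋₊ (t * α)‖ :=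
          integral_nonneg fun _ => norm_nonneg _
        have n2 : 0 ≤ ∫ t in coeffRange C, ‖vInt k P (t * α)‖ :=
          integral_nonneg fun _ => norm_nonneg _
        gcongr
    _ = ENNReal.ofReal ((c ^ s + (8 * C ^ 2) ^ s) * R ^ s) := by
        rw [← ENNReal.ofReal_add (by positivity) (by positivity)]
        rw [mul_pow c, mul_pow (8 * C ^ 2), ← add_mul]

theorem exists_meanDiff_le_of_abs_le {k : ℕ} (hk : 2 ≤ k) {s : ℕ} {C : ℝ} (hC : 2 ≤ C) :
    ∃ c : ℝ, 0 < c ∧ ∀ P : ℝ, 2 ≤ P → ∀ α : ℝ, |α| ≤ P ^ (-(k : ℝ) + 1 / 4) →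
      meanDiff k s C P α ≤ ENNReal.ofReal (c * P ^ ((s : ℝ) - 3 / 4)) := by
  have hpi := Real.pi_pos
  set K : ℝ := 3 + 4 * π * k * C with hK
  have hKpos : 0 < K := by positivity
  refine ⟨(s + 1) * 3 ^ s * K * (2 * C) ^ s, by positivity, fun P hP α hα => ?_⟩
  have hP0 : 0 < P := by linarith
  have hN : (⌊P⌋₊ : ℝ) ≤ P := Nat.floor_le hP0.le
  have hq : 1 ≤ P ^ (1 / 4 : ℝ) := Real.one_le_rpow (by linarith) (by norm_num)
  have hPk : P ^ (-(k : ℝ) + 1 / 4) * P ^ k = P ^ (1 / 4 : ℝ) := by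
    rw [← Real.rpow_natCast, ← Real.rpow_add hP0]; congr 1; ring
  have hbd : ∀ l ∈ coeffBox s C,
      ‖prodDiff k s P l α‖ ≤ (s + 1) * 3 ^ s * K * P ^ ((s : ℝ) - 3 / 4) := by
    intro l hl
    have h1 := norm_prod_sub_prod_mul_le Finset.univ (fun j => weylSum k ⌊P⌋₊ (l j * α))
      (fun j => vInt k P (l j * α)) (M := 3 * P) (ε := K * P ^ (1 / 4 : ℝ)) (by positivity)
      (fun j _ => (norm_weylSum_le _ _ _).trans (by linarith))
      (fun j _ => (norm_vInt_le _ hP0.le _).trans (by linarith))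
      (fun j _ => by
        refine (norm_weylSum_sub_vInt_le (by omega) _ hP0.le).trans ?_
        have hlj : |l j| ≤ C := (hl j (mem_univ j)).2
        rw [abs_mul]
        calc 3 + 4 * π * k * (|l j| * |α|) * P ^ k
            ≤ 3 * P ^ (1 / 4 : ℝ) + 4 * π * k * (C * P ^ (-(k : ℝ) + 1 / 4)) * P ^ k := by
              gcongr
              linarith
          _ = 3 * P ^ (1 / 4 : ℝ) + 4 * π * k * C * (P ^ (-(k : ℝ) + 1 / 4) * P ^ k) := by ring
          _ = K * P ^ (1 / 4 : ℝ) := by rw [hPk, hK]; ring)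
    rw [Finset.card_univ, Fintype.card_fin] at h1
    have h2 : ‖prodDiff k s P l α‖ * (3 * P) ≤
        ((s + 1) * 3 ^ s * K * P ^ ((s : ℝ) - 3 / 4)) * (3 * P) := by
      refine h1.trans ?_
      have h3 : P ^ ((s : ℝ) - 3 / 4) * P = P ^ s * P ^ (1 / 4 : ℝ) := by
        rw [← Real.rpow_natCast, ← Real.rpow_add hP0]
        nth_rewrite 2 [← Real.rpow_one P]
        rw [← Real.rpow_add hP0]; congr 1; ring
      calc (s : ℝ) * (3 * P) ^ s * (K * P ^ (1 / 4 : ℝ))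
          = s * (3 ^ s * K * (P ^ s * P ^ (1 / 4 : ℝ))) := by rw [mul_pow]; ring
        _ ≤ ((s + 1) * 3) * (3 ^ s * K * (P ^ s * P ^ (1 / 4 : ℝ))) := by
            gcongr
            have : (0 : ℝ) ≤ s := Nat.cast_nonneg s
            linarith
        _ = _ := by rw [← h3]; ring
    exact le_of_mul_le_mul_right h2 (by positivity)
  calc meanDiff k s C P α
      ≤ ∫⁻ _ in coeffBox s C, ENNReal.ofReal ((s + 1) * 3 ^ s * K * P ^ ((s : ℝ) - 3 / 4)) := by
        refine setLIntegral_mono measurable_const fun l hl => ?_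
        rw [← ofReal_norm]
        exact ENNReal.ofReal_le_ofReal (hbd l hl)
    _ ≤ ENNReal.ofReal ((s + 1) * 3 ^ s * K * P ^ ((s : ℝ) - 3 / 4)) *
          ENNReal.ofReal (2 * C) ^ s := by
        rw [setLIntegral_const]
        gcongr
        exact volume_coeffBox_le s C
    _ = _ := by
        rw [← ENNReal.ofReal_pow (by positivity), ← ENNReal.ofReal_mul (by positivity)]
        congr 1; ring

/-- The pointwise bound for `meanDiff` combining the ranges of small and large `α`. -/
theorem exists_meanDiff_le_add {k s : ℕ} (hk : 2 ≤ k) (hs : 2 * k < s) {C : ℝ} (hC : 2 ≤ C) :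
    ∃ c : ℝ, 0 < c ∧ ∀ P : ℝ, 2 ≤ P → ∀ α : ℝ, α ≠ 0 →
      meanDiff k s C P α ≤ ENNReal.ofReal (c * (P ^ ((s : ℝ) / 2) +
        P ^ ((s : ℝ) - 15 / 32) * (1 + (α / P ^ (-(k : ℝ) + 1 / 4)) ^ 2)⁻¹)) := by
  have hspos : (0 : ℝ) < s := by exact_mod_cast (by omega : 0 < s)
  have hkpos : (0 : ℝ) < k := by exact_mod_cast (by omega : 0 < k)
  obtain ⟨c₁, hc₁, h₁⟩ := exists_meanDiff_le hk s hC (κ := 1 / (32 * s)) (by positivity)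
  obtain ⟨c₂, hc₂, h₂⟩ := exists_meanDiff_le_of_abs_le (s := s) hk hC
  refine ⟨c₁ * 2 ^ s * 2 + c₂ * 2, by positivity, fun P hP α hα => ?_⟩
  have hP0 : 0 < P := by linarith
  have hP1 : 1 ≤ P := by linarith
  have hα' := abs_pos.2 hα
  set a : ℝ := P ^ (-(k : ℝ) + 1 / 4) with ha
  have hapos : 0 < a := by positivity
  have hsqabs : (α / a) ^ 2 = (|α| / a) ^ 2 := by rw [div_pow, div_pow, sq_abs]
  rw [hsqabs]
  rcases le_total |α| a with hle | hge
  · refine (h₂ P hP α hle).trans (ENNReal.ofReal_le_ofReal ?_)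
    have h3 : P ^ ((s : ℝ) - 3 / 4) ≤ P ^ ((s : ℝ) - 15 / 32) :=
      Real.rpow_le_rpow_of_exponent_le hP1 (by linarith)
    have h4 : (1 / 2 : ℝ) ≤ (1 + (|α| / a) ^ 2)⁻¹ := by
      have : (|α| / a) ^ 2 ≤ 1 := by
        refine pow_le_one₀ (by positivity) ?_
        rw [div_le_one hapos]; exact hle
      rw [← one_div]
      exact one_div_le_one_div_of_le (by positivity) (by linarith)
    calc c₂ * P ^ ((s : ℝ) - 3 / 4) ≤ c₂ * 2 * (0 + P ^ ((s : ℝ) - 15 / 32) * (1 / 2)) := by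
          linarith [mul_le_mul_of_nonneg_left h3 hc₂.le]
      _ ≤ (c₁ * 2 ^ s * 2 + c₂ * 2) * (P ^ ((s : ℝ) / 2) +
            P ^ ((s : ℝ) - 15 / 32) * (1 + (|α| / a) ^ 2)⁻¹) := by
          gcongr
          · have : 0 < c₁ * 2 ^ s * 2 := by positivity
            linarith
          · positivity
  · set z : ℝ := (a / |α|) ^ ((k : ℝ)⁻¹) with hz
    have hzk : z ^ k = a / |α| := Real.rpow_inv_natCast_pow (by positivity) (by omega)
    have hz0 : 0 < z := by positivity
    have hz1 : z ≤ 1 := Real.rpow_le_one (by positivity) ((div_le_one hα').2 hge) (by positivity)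
    set A : ℝ := P ^ (1 - 1 / (4 * (k : ℝ))) with hA
    have hAk : A ^ k = a⁻¹ := by
      rw [hA, ha, ← Real.rpow_natCast, ← Real.rpow_mul hP0.le, ← Real.rpow_neg hP0.le]
      congr 1; field_simp; ring
    have hYk : (A * z) ^ k = |α|⁻¹ := by
      rw [mul_pow, hAk, hzk]; field_simp
    have hb := h₁ P hP α (A * z) hα hYk (by positivity)
    refine hb.trans (ENNReal.ofReal_le_ofReal ?_)
    have h3 : (P ^ (1 / 2 : ℝ) + A * z * P ^ (1 / (32 * (s : ℝ)))) ^ s ≤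
        2 ^ s * ((P ^ (1 / 2 : ℝ)) ^ s + (A * z * P ^ (1 / (32 * (s : ℝ)))) ^ s) := by
      refine (add_pow_le (by positivity) (by positivity) s).trans ?_
      gcongr
      · norm_num
      · omega
    have h4 : (P ^ (1 / 2 : ℝ)) ^ s = P ^ ((s : ℝ) / 2) := by
      rw [← Real.rpow_natCast, ← Real.rpow_mul hP0.le]; congr 1; ring
    have h5 : A ^ s * (P ^ (1 / (32 * (s : ℝ)))) ^ s ≤ P ^ ((s : ℝ) - 15 / 32) := by
      rw [hA, ← Real.rpow_natCast, ← Real.rpow_mul hP0.le, ← Real.rpow_natCast,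
        ← Real.rpow_mul hP0.le, ← Real.rpow_add hP0]
      refine Real.rpow_le_rpow_of_exponent_le hP1 ?_
      have h6 : 1 / (32 * (s : ℝ)) * s = 1 / 32 := by field_simp
      have h7 : 1 / 2 ≤ 1 / (4 * (k : ℝ)) * s := by
        have : 2 * (k : ℝ) ≤ s := by exact_mod_cast hs.le
        rw [one_div_mul_eq_div, div_le_div_iff₀ (by norm_num) (by positivity)]
        linarith
      rw [h6]; linarith
    have h8 : z ^ s ≤ 2 * (1 + (|α| / a) ^ 2)⁻¹ := by
      have h9 : z ^ s ≤ (a / |α|) ^ 2 := by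
        rw [← hzk, ← pow_mul]
        exact pow_le_pow_of_le_one hz0.le hz1 (by omega)
      refine h9.trans ?_
      have h10 : 1 ≤ |α| / a := (one_le_div hapos).2 hge
      have h11 : (a / |α|) ^ 2 = ((|α| / a) ^ 2)⁻¹ := by rw [← inv_pow, inv_div]
      rw [h11, ← div_eq_mul_inv, ← one_div, div_le_div_iff₀ (by positivity) (by positivity)]
      nlinarith
    have h12 : (A * z * P ^ (1 / (32 * (s : ℝ)))) ^ s ≤
        P ^ ((s : ℝ) - 15 / 32) * (2 * (1 + (|α| / a) ^ 2)⁻¹) := by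
      calc (A * z * P ^ (1 / (32 * (s : ℝ)))) ^ s
          = (A ^ s * (P ^ (1 / (32 * (s : ℝ)))) ^ s) * z ^ s := by ring
        _ ≤ _ := by gcongr
    have hX : 0 < P ^ ((s : ℝ) / 2) := by positivity
    have hW : 0 < P ^ ((s : ℝ) - 15 / 32) * (1 + (|α| / a) ^ 2)⁻¹ := by positivity
    calc _ ≤ c₁ * (2 ^ s * (P ^ ((s : ℝ) / 2) +
            P ^ ((s : ℝ) - 15 / 32) * (2 * (1 + (|α| / a) ^ 2)⁻¹))) := by
          rw [h4] at h3
          refine mul_le_mul_of_nonneg_left (h3.trans ?_) hc₁.le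
          gcongr
      _ ≤ c₁ * (2 ^ s * (2 * P ^ ((s : ℝ) / 2) +
            P ^ ((s : ℝ) - 15 / 32) * (2 * (1 + (|α| / a) ^ 2)⁻¹))) := by
          gcongr
          linarith
      _ = c₁ * 2 ^ s * 2 * (P ^ ((s : ℝ) / 2) +
            P ^ ((s : ℝ) - 15 / 32) * (1 + (|α| / a) ^ 2)⁻¹) := by ring
      _ ≤ _ := by
          gcongr
          linarith

/-- An upper bound for the error `∫ (∏ f(λ_j α) − ∏ v(λ_j α)) d_η α`, uniform over
`P ^ (-1/8) ≤ η ≤ 2`. -/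
noncomputable def errBound (k s : ℕ) (P : ℝ) (l : Fin s → ℝ) : ℝ≥0∞ :=
  ∫⁻ α, ‖prodDiff k s P l α‖ₑ * ENNReal.ofReal (4 * P ^ (1 / 8 : ℝ) * (1 + α ^ 2)⁻¹)

theorem measurable_errBound_integrand (k s : ℕ) (P : ℝ) :
    Measurable fun p : (Fin s → ℝ) × ℝ =>
      ‖prodDiff k s P p.1 p.2‖ₑ * ENNReal.ofReal (4 * P ^ (1 / 8 : ℝ) * (1 + p.2 ^ 2)⁻¹) := by
  have h := (continuous_prodDiff k s P).measurable
  exact h.enorm.mul (by fun_prop)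

theorem measurable_errBound (k s : ℕ) (P : ℝ) : Measurable (errBound k s P) :=
  (measurable_errBound_integrand k s P).lintegral_prod_right'

theorem exists_lintegral_errBound_le {k s : ℕ} (hk : 2 ≤ k) (hs : 2 * k < s) {C : ℝ}
    (hC : 2 ≤ C) :
    ∃ c : ℝ, 0 < c ∧ ∀ P : ℝ, 2 ≤ P →
      ∫⁻ l in coeffBox s C, errBound k s P l ≤
        ENNReal.ofReal (c * P ^ ((s : ℝ) - k - 3 / 32)) := by
  obtain ⟨c, hc, h⟩ := exists_meanDiff_le_add hk hs hC
  have hpi := Real.pi_pos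
  refine ⟨8 * π * c, by positivity, fun P hP => ?_⟩
  have hP0 : 0 < P := by linarith
  have hP1 : 1 ≤ P := by linarith
  set a : ℝ := P ^ (-(k : ℝ) + 1 / 4) with ha
  have hapos : 0 < a := by positivity
  set Q : ℝ := P ^ (1 / 8 : ℝ) with hQ
  have hQpos : 0 < Q := by positivity
  have i1 : Integrable fun α : ℝ => (1 + α ^ 2)⁻¹ := integrable_inv_one_add_sq
  have i2 : Integrable fun α : ℝ => (1 + (α / a) ^ 2)⁻¹ := i1.comp_div hapos.ne'
  have v2 : ∫ α : ℝ, (1 + (α / a) ^ 2)⁻¹ = a * π := by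
    rw [Measure.integral_comp_div (fun x : ℝ => (1 + x ^ 2)⁻¹) a, integral_univ_inv_one_add_sq,
      abs_of_pos hapos, smul_eq_mul]
  have hae : ∀ᵐ α : ℝ, α ≠ 0 := by simp [ae_iff]
  calc ∫⁻ l in coeffBox s C, errBound k s P l
      = ∫⁻ α : ℝ, ∫⁻ l in coeffBox s C,
          ‖prodDiff k s P l α‖ₑ * ENNReal.ofReal (4 * Q * (1 + α ^ 2)⁻¹) :=
        lintegral_lintegral_swap (measurable_errBound_integrand k s P).aemeasurable
    _ = ∫⁻ α : ℝ, meanDiff k s C P α * ENNReal.ofReal (4 * Q * (1 + α ^ 2)⁻¹) := by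
        refine lintegral_congr fun α => ?_
        refine lintegral_mul_const _ ?_
        exact ((continuous_prodDiff k s P).comp (by fun_prop :
          Continuous fun l : Fin s → ℝ => (l, α))).measurable.enorm
    _ ≤ ∫⁻ α : ℝ, ENNReal.ofReal (4 * c * (Q * P ^ ((s : ℝ) / 2) * (1 + α ^ 2)⁻¹ +
          Q * P ^ ((s : ℝ) - 15 / 32) * (1 + (α / a) ^ 2)⁻¹)) := by
        refine lintegral_mono_ae ?_
        filter_upwards [hae] with α hα
        refine (mul_le_mul_left (h P hP α hα) _).trans ?_
        rw [← ENNReal.ofReal_mul (by positivity)]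
        refine ENNReal.ofReal_le_ofReal ?_
        have h1 : (1 + α ^ 2)⁻¹ ≤ 1 := inv_le_one_of_one_le₀ (by nlinarith)
        have h2 : P ^ ((s : ℝ) - 15 / 32) * (1 + (α / a) ^ 2)⁻¹ * (1 + α ^ 2)⁻¹ ≤
            P ^ ((s : ℝ) - 15 / 32) * (1 + (α / a) ^ 2)⁻¹ * 1 := by gcongr
        have h3 : 0 ≤ 4 * c * Q := by positivity
        have h4 := mul_le_mul_of_nonneg_left h2 h3
        rw [← ha]
        nlinarith
    _ = ENNReal.ofReal (4 * c * (Q * P ^ ((s : ℝ) / 2) * π +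
          Q * P ^ ((s : ℝ) - 15 / 32) * (a * π))) := by
        have i3 : Integrable fun α : ℝ => 4 * c * (Q * P ^ ((s : ℝ) / 2) * (1 + α ^ 2)⁻¹ +
            Q * P ^ ((s : ℝ) - 15 / 32) * (1 + (α / a) ^ 2)⁻¹) :=
          ((i1.const_mul _).add (i2.const_mul _)).const_mul _
        rw [← ofReal_integral_eq_lintegral_ofReal i3 (ae_of_all _ fun α => by positivity),
          integral_const_mul, integral_add (i1.const_mul _) (i2.const_mul _), integral_const_mul,
          integral_const_mul, integral_univ_inv_one_add_sq, v2]
    _ ≤ _ := by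
        refine ENNReal.ofReal_le_ofReal ?_
        have hks : 2 * (k : ℝ) + 1 ≤ s := by exact_mod_cast hs
        have hk' : (2 : ℝ) ≤ k := by exact_mod_cast hk
        have e1 : Q * P ^ ((s : ℝ) / 2) ≤ P ^ ((s : ℝ) - k - 3 / 32) := by
          rw [hQ, ← Real.rpow_add hP0]
          exact Real.rpow_le_rpow_of_exponent_le hP1 (by linarith)
        have e2 : Q * P ^ ((s : ℝ) - 15 / 32) * a = P ^ ((s : ℝ) - k - 3 / 32) := by
          rw [hQ, ha, ← Real.rpow_add hP0, ← Real.rpow_add hP0]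
          congr 1; ring
        calc 4 * c * (Q * P ^ ((s : ℝ) / 2) * π + Q * P ^ ((s : ℝ) - 15 / 32) * (a * π))
            = 4 * c * π * (Q * P ^ ((s : ℝ) / 2) + Q * P ^ ((s : ℝ) - 15 / 32) * a) := by ring
          _ ≤ 4 * c * π * (P ^ ((s : ℝ) - k - 3 / 32) + P ^ ((s : ℝ) - k - 3 / 32)) := by
              rw [e2]; gcongr
          _ = _ := by ring

theorem enorm_Icount_sub_integral_le {k s : ℕ} {P : ℝ} (hP : 2 ≤ P) (l : Fin s → ℝ) {η : ℝ}
    (h1 : P ^ (-(1 / 8) : ℝ) ≤ η) (h2 : η ≤ 2) :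
    ‖(Icount k s l P η : ℂ) - ∫ α, ∏ j, vInt k P (l j * α) ∂dEta η‖ₑ ≤ errBound k s P l := by
  have hP0 : 0 < P := by linarith
  have hη : 0 < η := lt_of_lt_of_le (by positivity) h1
  have := isFiniteMeasure_dEta hη
  have hf := continuous_weylSum k ⌊P⌋₊
  have hv := continuous_vInt k P
  have i1 : Integrable (fun α => ∏ j, weylSum k ⌊P⌋₊ (l j * α)) (dEta η) := by
    refine Integrable.of_bound (Continuous.aestronglyMeasurable (by fun_prop))
      (∏ _j : Fin s, (2 * (⌊P⌋₊ : ℝ) + 1)) (ae_of_all _ fun α => ?_)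
    rw [norm_prod]
    exact Finset.prod_le_prod (fun _ _ => norm_nonneg _) fun j _ => norm_weylSum_le _ _ _
  have i2 : Integrable (fun α => ∏ j, vInt k P (l j * α)) (dEta η) := by
    refine Integrable.of_bound (Continuous.aestronglyMeasurable (by fun_prop))
      (∏ _j : Fin s, (2 * P)) (ae_of_all _ fun α => ?_)
    rw [norm_prod]
    exact Finset.prod_le_prod (fun _ _ => norm_nonneg _) fun j _ => norm_vInt_le _ hP0.le _
  rw [← integral_prod_weylSum k s l hP0.le hη, ← integral_sub i1 i2, integral_dEta hη]
  refine (enorm_integral_le_lintegral_enorm _).trans (lintegral_mono fun α => ?_)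
  rw [enorm_smul, mul_comm, Real.enorm_eq_ofReal (sincSq_nonneg hη α)]
  refine mul_le_mul_right (ENNReal.ofReal_le_ofReal ?_) _
  refine sincSq_le_of_mem (Real.one_le_rpow (by linarith) (by norm_num)) ?_ h2 α
  rwa [one_div, ← Real.rpow_neg hP0.le]

theorem Icount_nonneg (k s : ℕ) (l : Fin s → ℝ) (P η : ℝ) : 0 ≤ Icount k s l P η :=
  Finset.sum_nonneg fun _ _ => le_max_left _ _

theorem Icount_mono (k s : ℕ) (l : Fin s → ℝ) (P : ℝ) {η η' : ℝ} (hη : 0 < η) (h : η ≤ η') :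
    Icount k s l P η ≤ Icount k s l P η' := by
  refine Finset.sum_le_sum fun x _ => ?_
  gcongr

theorem norm_integral_prod_vInt_le (k : ℕ) {s : ℕ} {P : ℝ} (hP : 0 ≤ P) (l : Fin s → ℝ) {η : ℝ}
    (hη : 0 < η) : ‖∫ α, ∏ j, vInt k P (l j * α) ∂dEta η‖ ≤ (2 * P) ^ s := by
  have := isFiniteMeasure_dEta hη
  have h := norm_integral_le_of_norm_le_const (μ := dEta η)
    (f := fun α => ∏ j, vInt k P (l j * α)) (C := (2 * P) ^ s) (ae_of_all _ fun α => by
      rw [norm_prod]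
      refine (Finset.prod_le_prod (fun _ _ => norm_nonneg _)
        fun j _ => norm_vInt_le k hP (l j * α)).trans ?_
      rw [Finset.prod_const, Finset.card_univ, Fintype.card_fin])
  rwa [measureReal_dEta_univ hη, mul_one] at h

theorem LamC_subset_coeffBox (k s : ℕ) (C : ℝ) : LamC k s C ⊆ coeffBox s C :=
  fun _ hl j _ => hl.2 j

theorem dlt_pos (k : ℕ) : 0 < dlt k := by unfold dlt; positivity

theorem dlt_le {k : ℕ} (hk : 2 ≤ k) : dlt k ≤ 1 / 4096 := by
  unfold dlt
  rw [one_div]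
  refine inv_anti₀ (by norm_num) ?_
  calc (4096 : ℝ) = 8 ^ (2 * 2) := by norm_num
    _ ≤ 8 ^ (2 * k) := pow_le_pow_right₀ (by norm_num) (by omega)

theorem ofReal_le_errBound {k s : ℕ} {C : ℝ} {J : (Fin s → ℝ) → ℝ}
    {c₀ B T P : ℝ} (hP : 2 ≤ P)
    (hJ : ∀ η : ℝ, 0 < η → η ≤ 2 → ∀ l ∈ LamC k s C,
        ‖(∫ α, ∏ j, vInt k P (l j * α) ∂dEta η) -
            ((η * J l * P ^ ((s : ℝ) - k) : ℝ) : ℂ)‖ ≤ c₀ * P ^ ((s : ℝ) - 2 * k))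
    {l : Fin s → ℝ} (hl : l ∈ LamC k s C) (hJ0 : 0 < J l) (hJB : J l ≤ B)
    (hT : c₀ * P ^ ((s : ℝ) - 2 * k) + B * P ^ ((s : ℝ) - k - 1 / 8) ≤ T)
    {η : ℝ} (hη : 0 < η) (hη2 : η ≤ 2)
    (hbad : 2 * T < |Icount k s l P η - η * J l * P ^ ((s : ℝ) - k)|) :
    ENNReal.ofReal T ≤ errBound k s P l := by
  have hP0 : 0 < P := by linarith
  by_contra! hlt
  have hTpos : 0 < T := ENNReal.ofReal_pos.1 (pos_of_gt hlt)
  set η₀ : ℝ := P ^ (-(1 / 8) : ℝ) with hη₀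
  have hη₀pos : 0 < η₀ := by positivity
  have hη₀le : η₀ ≤ 2 :=
    (Real.rpow_le_one_of_one_le_of_nonpos (by linarith) (by norm_num)).trans (by norm_num)
  have key : ∀ η' : ℝ, η₀ ≤ η' → η' ≤ 2 →
      |Icount k s l P η' - η' * J l * P ^ ((s : ℝ) - k)| ≤ T + c₀ * P ^ ((s : ℝ) - 2 * k) := by
    intro η' h1 h2
    have a1 := (enorm_Icount_sub_integral_le (k := k) hP l h1 h2).trans hlt.le
    rw [← ofReal_norm, ENNReal.ofReal_le_ofReal_iff hTpos.le] at a1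
    have a2 := hJ η' (hη₀pos.trans_le h1) h2 l hl
    rw [← Real.norm_eq_abs, ← Complex.norm_real]
    push_cast at a2 ⊢
    exact (norm_sub_le_norm_sub_add_norm_sub _ _ _).trans (add_le_add a1 a2)
  have hD : 0 < P ^ ((s : ℝ) - k) := by positivity
  have hDB : η₀ * J l * P ^ ((s : ℝ) - k) ≤ B * P ^ ((s : ℝ) - k - 1 / 8) := by
    have : P ^ ((s : ℝ) - k - 1 / 8) = η₀ * P ^ ((s : ℝ) - k) := by
      rw [hη₀, ← Real.rpow_add hP0]; congr 1; ring
    rw [this]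
    calc η₀ * J l * P ^ ((s : ℝ) - k) = J l * (η₀ * P ^ ((s : ℝ) - k)) := by ring
      _ ≤ _ := by gcongr
  rcases le_total η₀ η with hge | hle
  · have h1 := key η hge hη2
    have h2 : 0 < η₀ * J l * P ^ ((s : ℝ) - k) := by positivity
    linarith
  · have h1 := abs_le.1 (key η₀ le_rfl hη₀le)
    have h2 := Icount_mono k s l P hη hle
    have h3 := Icount_nonneg k s l P η
    have h4 : η * J l * P ^ ((s : ℝ) - k) ≤ η₀ * J l * P ^ ((s : ℝ) - k) := by gcongr
    have h5 : 0 < η * J l * P ^ ((s : ℝ) - k) := by positivity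
    have h6 : 0 ≤ c₀ * P ^ ((s : ℝ) - 2 * k) :=
      (norm_nonneg _).trans (hJ η hη hη2 l hl)
    rcases lt_abs.1 hbad with h | h <;> linarith

theorem add_rpow_le_of_pow_le {k s : ℕ} (hk : 2 ≤ k) {c₀ B P : ℝ} (hc₀ : 0 < c₀) (hB : 0 < B)
    (hP : 2 ≤ P) (h : (c₀ + B) ^ 16 ≤ P) :
    c₀ * P ^ ((s : ℝ) - 2 * k) + B * P ^ ((s : ℝ) - k - 1 / 8) ≤
      P ^ ((s : ℝ) - k - 3 * dlt k) := by
  have hP0 : 0 < P := by linarith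
  have hk' : (2 : ℝ) ≤ k := by exact_mod_cast hk
  have hδ := dlt_le hk
  have h1 : P ^ ((s : ℝ) - 2 * k) ≤ P ^ ((s : ℝ) - k - 1 / 8) :=
    Real.rpow_le_rpow_of_exponent_le (by linarith) (by linarith)
  have h2 : c₀ + B ≤ P ^ (1 / 16 : ℝ) := by
    have := Real.rpow_le_rpow (by positivity) h (by norm_num : (0 : ℝ) ≤ 1 / 16)
    rwa [← Real.rpow_natCast, ← Real.rpow_mul (by positivity),
      (by norm_num : ((16 : ℕ) : ℝ) * (1 / 16) = 1), Real.rpow_one] at this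
  calc c₀ * P ^ ((s : ℝ) - 2 * k) + B * P ^ ((s : ℝ) - k - 1 / 8)
      ≤ c₀ * P ^ ((s : ℝ) - k - 1 / 8) + B * P ^ ((s : ℝ) - k - 1 / 8) := by gcongr
    _ = (c₀ + B) * P ^ ((s : ℝ) - k - 1 / 8) := by ring
    _ ≤ P ^ (1 / 16 : ℝ) * P ^ ((s : ℝ) - k - 1 / 8) := by gcongr
    _ = P ^ ((s : ℝ) - k - 1 / 16) := by rw [← Real.rpow_add hP0]; congr 1; ring
    _ ≤ _ := Real.rpow_le_rpow_of_exponent_le (by linarith) (by linarith)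

/-- For k ≥ 2, s > 2k, C ≥ 2, δ = 8^{−2k}, and J_{k,s} the continuous
positive singular-integral function, the set 𝒦(P) of λ ∈ Λ_k^{(s)}(C) for which
|I_λ(P,η) − η J_{k,s}(λ) P^{s−k}| > 2 P^{s−k−3δ} for some 0 < η ≤ 2 has Lebesgue
measure ≪ P^{−3δ}. -/
theorem stmt16 (k s : ℕ) (hk : 2 ≤ k) (hs : 2 * k < s) (C : ℝ) (hC : 2 ≤ C)
    (J : (Fin s → ℝ) → ℝ) (hJc : ContinuousOn J (Lam k s))
    (hJp : ∀ l ∈ Lam k s, 0 < J l)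
    (hJ : ∃ c₀ : ℝ, 0 < c₀ ∧ ∀ P : ℝ, 2 ≤ P → ∀ η : ℝ, 0 < η → η ≤ 2 →
      ∀ l ∈ LamC k s C,
        ‖(∫ α, ∏ j, vInt k P (l j * α) ∂dEta η) -
            ((η * J l * P ^ ((s : ℝ) - k) : ℝ) : ℂ)‖ ≤ c₀ * P ^ ((s : ℝ) - 2 * k)) :
    ∃ c : ℝ, 0 < c ∧ ∀ P : ℝ, 2 ≤ P →
      volume {l : Fin s → ℝ | l ∈ LamC k s C ∧ ∃ η : ℝ, 0 < η ∧ η ≤ 2 ∧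
          2 * P ^ ((s : ℝ) - k - 3 * dlt k) <
            |Icount k s l P η - η * J l * P ^ ((s : ℝ) - k)|}
        ≤ ENNReal.ofReal (c * P ^ (-(3 * dlt k))) := by
  obtain ⟨c₀, hc₀, hJ⟩ := hJ
  obtain ⟨c₁, hc₁, hE⟩ := exists_lintegral_errBound_le hk hs hC
  have hδ0 := dlt_pos k
  have hδ1 := dlt_le hk
  set B : ℝ := c₀ * 2 ^ ((s : ℝ) - 2 * k) + (2 * 2) ^ s with hB
  have hBpos : 0 < B := by positivity
  have hJB : ∀ l ∈ LamC k s C, J l ≤ B := by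
    intro l hl
    have h1 := hJ 2 le_rfl 2 (by norm_num) le_rfl l hl
    have h2 := norm_integral_prod_vInt_le k (by norm_num : (0 : ℝ) ≤ 2) l
      (by norm_num : (0 : ℝ) < 2)
    have h3 := norm_sub_norm_le (((2 * J l * 2 ^ ((s : ℝ) - k) : ℝ) : ℂ))
      (∫ α, ∏ j, vInt k 2 (l j * α) ∂dEta 2)
    rw [norm_sub_rev, Complex.norm_real] at h3
    have h4 := le_abs_self (2 * J l * 2 ^ ((s : ℝ) - k))
    rw [← Real.norm_eq_abs] at h4
    have hks : (k : ℝ) ≤ s := by exact_mod_cast (by omega : k ≤ s)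
    have h5 : (1 : ℝ) ≤ 2 ^ ((s : ℝ) - k) := Real.one_le_rpow (by norm_num) (by linarith)
    have h6 := mul_le_mul_of_nonneg_left h5 (hJp l hl.1).le
    have h7 := hJp l hl.1
    linarith
  set P₀ : ℝ := (c₀ + B) ^ 16 with hP₀
  have hP₀pos : 0 < P₀ := by positivity
  refine ⟨c₁ + (2 * C) ^ s * P₀ ^ (3 * dlt k), by positivity, fun P hP => ?_⟩
  have hP0 : 0 < P := by linarith
  set T : ℝ := P ^ ((s : ℝ) - k - 3 * dlt k) with hT
  have hTpos : 0 < T := by positivity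
  rcases le_total P₀ P with hge | hle
  · have hTb := add_rpow_le_of_pow_le (s := s) hk hc₀ hBpos hP hge
    have hmk := meas_ge_le_lintegral_div (μ := volume.restrict (coeffBox s C))
      (measurable_errBound k s P).aemeasurable (ε := ENNReal.ofReal T)
      (by simpa using hTpos) ENNReal.ofReal_ne_top
    rw [Measure.restrict_apply' (measurableSet_coeffBox s C)] at hmk
    calc _ ≤ volume ({l | ENNReal.ofReal T ≤ errBound k s P l} ∩ coeffBox s C) := by
          refine measure_mono ?_
          rintro l ⟨hl, η, hη, hη2, hbad⟩
          exact ⟨ofReal_le_errBound hP (hJ P hP) hl (hJp l hl.1) (hJB l hl) hTb hη hη2 hbad,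
            LamC_subset_coeffBox k s C hl⟩
      _ ≤ ENNReal.ofReal (c₁ * P ^ ((s : ℝ) - k - 3 / 32)) / ENNReal.ofReal T :=
          hmk.trans (ENNReal.div_le_div_right (hE P hP) _)
      _ = ENNReal.ofReal (c₁ * P ^ (-(3 / 32) + 3 * dlt k)) := by
          rw [← ENNReal.ofReal_div_of_pos hTpos, mul_div_assoc, hT, ← Real.rpow_sub hP0]
          congr 3; ring
      _ ≤ _ := by
          refine ENNReal.ofReal_le_ofReal ?_
          gcongr
          · have : 0 ≤ (2 * C) ^ s * P₀ ^ (3 * dlt k) := by positivity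
            linarith
          · linarith
          · linarith
  · calc _ ≤ volume (coeffBox s C) :=
          measure_mono fun l hl => LamC_subset_coeffBox k s C hl.1
      _ ≤ ENNReal.ofReal (2 * C) ^ s := volume_coeffBox_le s C
      _ = ENNReal.ofReal ((2 * C) ^ s) := (ENNReal.ofReal_pow (by linarith) s).symm
      _ ≤ _ := by
          refine ENNReal.ofReal_le_ofReal ?_
          have h1 : P ^ (3 * dlt k) * P ^ (-(3 * dlt k)) = 1 := by
            rw [← Real.rpow_add hP0, add_neg_cancel, Real.rpow_zero]
          calc (2 * C) ^ s = (2 * C) ^ s * (P ^ (3 * dlt k) * P ^ (-(3 * dlt k))) := by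
                rw [h1, mul_one]
            _ ≤ (2 * C) ^ s * (P₀ ^ (3 * dlt k) * P ^ (-(3 * dlt k))) := by gcongr
            _ = (2 * C) ^ s * P₀ ^ (3 * dlt k) * P ^ (-(3 * dlt k)) := by ring
            _ ≤ _ := by
                gcongr
                linarith
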